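/- arXiv:1911.07162 — 17 statements merged into one kernel-verified Lean document; each statement's English description precedes it below -/
import Mathlib

section
/- Let w and c be distinct candidates. Let H be the directed graph on vertex set V × C whose edges are: a 'preference edge' (v,x) → (v,y) whenever x ≻_v y, and a 'sideways edge' (v,x) → (v',x) for every candidate x and all voters v ≠ v'. Let f assign a nonnegative real f_e to every edge e of H such that for every voter v and every candidate x ≠ c, the total flow leaving node (v,x) equals the total flow entering (v,x), plus 1 if x = w and plus 0 otherwise (that is, exactly one unit of flow originates at each node (v,w), and flow is only absorbed at nodes (v,c)). For each voter v define FlCost(f,v) = Σ_{edges e of H into (v,c)} f_e + Σ_{x ∈ C, x ≠ c} Σ_{v' ∈ V, v' ≠ v} ( f_{(v',x)→(v,x)} + f_{(v,x)→(v',x)} ). Then for every pseudometric d consistent with the profile, cost(w) ≤ cost(c) · max_{v ∈ V} FlCost(f,v). -/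
/-- The flow-based dual bound (Lemma `dual-flow`).
Voters `V` (finite, nonempty), candidates `C` (finite); `P v x y` means voter `v`
strictly prefers `x` over `y`.  `H` is the directed graph on `V × C` with
preference edges `(v,x) → (v,y)` whenever `P v x y` and sideways edges
`(v,x) → (v',x)` for `v ≠ v'`.  `f` is a nonnegative flow on the edges of `H`
(zero off edges), one unit originating at each `(v,w)` and flow only absorbed at
nodes `(v,c)`.  Then `cost w ≤ cost c * max_v FlCost(f,v)`. -/
theorem stmt_0
    {V C : Type*} [Fintype V] [Nonempty V] [Fintype C]
    [DecidableEq V] [DecidableEq C]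
    (P : V → C → C → Prop) (hP : ∀ v, IsStrictTotalOrder C (P v))
    (w c : C) (hwc : w ≠ c)
    (f : (V × C) → (V × C) → ℝ)
    (hf0 : ∀ a b, 0 ≤ f a b)
    (hedge : ∀ a b : V × C,
      ¬ ((a.1 = b.1 ∧ P a.1 a.2 b.2) ∨ (a.2 = b.2 ∧ a.1 ≠ b.1)) → f a b = 0)
    (hflow : ∀ (v : V) (x : C), x ≠ c →
      (∑ b : V × C, f (v, x) b)
        = (∑ a : V × C, f a (v, x)) + (if x = w then 1 else 0))
    (d : V → C → ℝ)
    (hd0 : ∀ v x, 0 ≤ d v x)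
    (htri : ∀ v v' x y, d v x ≤ d v y + d v' y + d v' x)
    (hcons : ∀ v x y, P v x y → d v x ≤ d v y) :
    (∑ v, d v w) ≤ (∑ v, d v c) *
      (Finset.univ.sup' Finset.univ_nonempty (fun v : V =>
        (∑ a : V × C, f a (v, c)) +
        ∑ x ∈ Finset.univ.filter (fun x : C => x ≠ c),
          ∑ v' ∈ Finset.univ.filter (fun v' : V => v' ≠ v),
            (f (v', x) (v, x) + f (v, x) (v', x)))) := by
  classical
  set h : V × C → ℝ := fun a => if a.2 = c then 0 else d a.1 a.2 with hh
  set D : V × C → V × C → ℝ := fun a b =>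
    if a.2 = b.2 ∧ a.2 ≠ c ∧ a.1 ≠ b.1 then 1 else 0 with hD
  have e1 : (∑ v, d v w) = ∑ a : V × C, h a * ((∑ b, f a b) - ∑ b, f b a) := by
    rw [Fintype.sum_prod_type]
    refine Finset.sum_congr rfl fun v _ => ?_
    rw [Finset.sum_eq_single w]
    · rw [hflow v w hwc]; simp [hh, hwc]
    · intro x _ hx
      by_cases hc : x = c
      · simp [hh, hc]
      · rw [hflow v x hc]; simp [hx]
    · simp
  have e2 : ∑ a : V × C, h a * ((∑ b, f a b) - ∑ b, f b a)
      = ∑ a, ∑ b, f a b * (h a - h b) := by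
    simp only [mul_sub, Finset.mul_sum, Finset.sum_sub_distrib]
    rw [Finset.sum_comm (f := fun a b => f a b * h b)]
    simp only [mul_comm]
  have e3 : ∑ a, ∑ b, f a b * (h a - h b) ≤
      ∑ a : V × C, ∑ b : V × C, (f a b * (if b.2 = c then d b.1 c else 0)
        + (f a b * D a b * d a.1 c + f a b * D a b * d b.1 c)) := by
    refine Finset.sum_le_sum fun a _ => Finset.sum_le_sum fun b _ => ?_
    by_cases he : (a.1 = b.1 ∧ P a.1 a.2 b.2) ∨ (a.2 = b.2 ∧ a.1 ≠ b.1)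
    · have : h a - h b ≤ (if b.2 = c then d b.1 c else 0) + D a b * (d a.1 c + d b.1 c) := by
        obtain ⟨v, x⟩ := a
        obtain ⟨v', y⟩ := b
        simp only [hh, hD]
        dsimp only at he ⊢
        rcases he with ⟨rfl, hp⟩ | ⟨rfl, hv⟩
        · have h1 := hcons _ _ _ hp
          have h2 := hd0 v c
          have h3 := hd0 v y
          by_cases hx : x = c <;> by_cases hy : y = c <;> simp_all
        · have h1 := htri v v' x c
          have h2 := hd0 v' c
          by_cases hx : x = c
          · simp [hx, h2]
          · simp [hx, hv]; linarith
      have := mul_le_mul_of_nonneg_left this (hf0 a b)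
      linarith
    · simp [hedge a b he]
  have e4 : ∑ a : V × C, ∑ b : V × C, (f a b * (if b.2 = c then d b.1 c else 0)
        + (f a b * D a b * d a.1 c + f a b * D a b * d b.1 c))
      = ∑ v, d v c * ((∑ a : V × C, f a (v, c)) +
        ∑ x ∈ Finset.univ.filter (fun x : C => x ≠ c),
          ∑ v' ∈ Finset.univ.filter (fun v' : V => v' ≠ v),
            (f (v', x) (v, x) + f (v, x) (v', x))) := by
    have p1 : ∑ a : V × C, ∑ b : V × C, f a b * (if b.2 = c then d b.1 c else 0)
        = ∑ v, d v c * ∑ a : V × C, f a (v, c) := by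
      rw [Finset.sum_comm, Fintype.sum_prod_type]
      refine Finset.sum_congr rfl fun v _ => ?_
      rw [Finset.sum_eq_single c]
      · simp [Finset.mul_sum, mul_comm]
      · intro x _ hx; simp [hx]
      · simp
    have p2 : ∑ a : V × C, ∑ b : V × C, f a b * D a b * d a.1 c
        = ∑ v, d v c * ∑ x ∈ Finset.univ.filter (fun x : C => x ≠ c),
          ∑ v' ∈ Finset.univ.filter (fun v' : V => v' ≠ v), f (v, x) (v', x) := by
      rw [Fintype.sum_prod_type]
      refine Finset.sum_congr rfl fun v _ => ?_
      rw [Finset.sum_filter, Finset.mul_sum]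
      refine Finset.sum_congr rfl fun x _ => ?_
      rw [Fintype.sum_prod_type, Finset.sum_filter]
      by_cases hx : x = c
      · simp [hD, hx]
      · rw [if_pos hx, Finset.mul_sum]
        refine Finset.sum_congr rfl fun v' _ => ?_
        rw [Finset.sum_eq_single x]
        · by_cases hv : v = v'
          · simp [hD, hv]
          · simp [hD, hv, hx, Ne.symm hv, mul_comm]
        · intro y _ hy; simp [hD, Ne.symm hy]
        · simp
    have p3 : ∑ a : V × C, ∑ b : V × C, f a b * D a b * d b.1 c
        = ∑ v, d v c * ∑ x ∈ Finset.univ.filter (fun x : C => x ≠ c),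
          ∑ v' ∈ Finset.univ.filter (fun v' : V => v' ≠ v), f (v', x) (v, x) := by
      rw [Finset.sum_comm, Fintype.sum_prod_type]
      refine Finset.sum_congr rfl fun v _ => ?_
      rw [Finset.sum_filter, Finset.mul_sum]
      refine Finset.sum_congr rfl fun x _ => ?_
      rw [Fintype.sum_prod_type, Finset.sum_filter]
      by_cases hx : x = c
      · subst hx
        simp only [ne_eq, not_true_eq_false, if_false, mul_zero]
        refine Finset.sum_eq_zero fun v' _ => Finset.sum_eq_zero fun y _ => ?_
        have : D (v', y) (v, x) = 0 := by
          simp only [hD]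
          rw [if_neg]
          rintro ⟨q1, q2, -⟩
          exact q2 q1
        rw [this]; ring
      · rw [if_pos hx, Finset.mul_sum]
        refine Finset.sum_congr rfl fun v' _ => ?_
        rw [Finset.sum_eq_single x]
        · by_cases hv : v' = v
          · simp [hD, hv]
          · simp [hD, hv, hx, mul_comm]
        · intro y _ hy; simp [hD, hy]
        · simp
    simp only [Finset.sum_add_distrib, mul_add] at p1 p2 p3 ⊢
    rw [p1, p2, p3]
    ring
  rw [e1, e2]
  refine e3.trans ?_
  rw [e4, Finset.sum_mul]
  refine Finset.sum_le_sum fun v _ => mul_le_mul_of_nonneg_left ?_ (hd0 v c)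
  exact Finset.le_sup' (fun v : V =>
        (∑ a : V × C, f a (v, c)) +
        ∑ x ∈ Finset.univ.filter (fun x : C => x ≠ c),
          ∑ v' ∈ Finset.univ.filter (fun v' : V => v' ≠ v),
            (f (v', x) (v, x) + f (v, x) (v', x))) (Finset.mem_univ v)
end

section
/- Let ℓ ≥ 2 and let x_1, x_2, …, x_ℓ be distinct candidates, and for each i = 2, …, ℓ let α_i ∈ (0,1] be such that at least α_i·m voters v have x_{i-1} ≻_v x_i. Define λ_1 = 1, λ_2 = 2/α_2 − 1, and λ_i = 2/α_i for 2 < i ≤ ℓ. Call a set S ⊆ {1, …, ℓ} independent if it contains no two consecutive integers, and let Λ = max over independent sets S of Σ_{i ∈ S} λ_i. Then for every pseudometric d consistent with the profile, cost(x_1) ≤ Λ · cost(x_ℓ). -/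
noncomputable def pathM (l : ℕ → ℝ) : ℕ → ℝ
  | 0 => 0
  | 1 => l 0
  | (n+2) => max (pathM l (n+1)) (pathM l n + l (n+1))

lemma pathM_indep (l : ℕ → ℝ) : ∀ n, ∃ S : Finset ℕ, (∀ i ∈ S, i < n) ∧
    (∀ i ∈ S, ∀ j ∈ S, i + 1 ≠ j) ∧ pathM l n = ∑ i ∈ S, l i
  | 0 => ⟨∅, by simp, by simp, by simp [pathM]⟩
  | 1 => ⟨{0}, by simp, by simp, by simp [pathM]⟩
  | (n+2) => by
    obtain ⟨S, h1, h2, h3⟩ := pathM_indep l n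
    obtain ⟨T, g1, g2, g3⟩ := pathM_indep l (n+1)
    rcases le_total (pathM l n + l (n+1)) (pathM l (n+1)) with h | h
    · refine ⟨T, fun i hi => by have := g1 i hi; omega, g2, ?_⟩
      rw [pathM, max_eq_left h, g3]
    · refine ⟨insert (n+1) S, ?_, ?_, ?_⟩
      · intro i hi
        rcases Finset.mem_insert.1 hi with rfl | hi
        · omega
        · have := h1 i hi; omega
      · intro i hi j hj
        rcases Finset.mem_insert.1 hi with rfl | hi <;> rcases Finset.mem_insert.1 hj with rfl | hj
        · omega
        · have := h1 j hj; omega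
        · have := h1 i hi; omega
        · exact h2 i hi j hj
      · rw [Finset.sum_insert, pathM, max_eq_right h, h3, add_comm]
        intro hh; have := h1 _ hh; omega

lemma path_core {V : Type*} [Fintype V] (c : V → ℕ → ℝ) (z : V → ℝ) (t a l : ℕ → ℝ)
    (hz : ∀ v, 0 ≤ z v)
    (ha : ∀ i, 1 ≤ i → 0 < a i)
    (ht1 : ∀ v i, c v i ≤ z v + t i) (ht2 : ∀ v i, t i ≤ c v i + z v)
    (hA : ∀ i, a (i+1) * (Fintype.card V : ℝ) ≤ ∑ v, if c v i ≤ c v (i+1) then (1:ℝ) else 0)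
    (hl0 : l 0 = 1) (hl1 : l 1 = 2 / a 1 - 1) (hl2 : ∀ i, 2 ≤ i → l i = 2 / a i)
    (n : ℕ) (htn : t (n+1) = 0) :
    ∑ v, c v 0 ≤ pathM l (n+2) * ∑ v, z v := by
  set m : ℝ := (Fintype.card V : ℝ) with hm
  have hm0 : 0 ≤ m := by positivity
  set w : ℕ → ℝ := fun i => max 0 (t i - t (i+1)) with hw
  have hw0 : ∀ i, 0 ≤ w i := fun i => le_max_left _ _
  have hw1 : ∀ i, t i - t (i+1) ≤ w i := fun i => le_max_right _ _
  -- B i is step from i to i+1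
  set B : ℕ → ℝ := fun i => a (i+1) * m * w i with hB
  have hB0 : ∀ i, 0 ≤ B i := fun i =>
    mul_nonneg (mul_nonneg (ha _ (by omega)).le hm0) (hw0 i)
  have hBs : ∀ i, B i ≤ ∑ v, if c v i ≤ c v (i+1) then w i else 0 := by
    intro i
    have := mul_le_mul_of_nonneg_right (hA i) (hw0 i)
    rw [Finset.sum_mul] at this
    simpa [hB, ite_mul] using this
  set K : ℝ := 2 * ∑ v, z v with hK
  have hBK : ∀ i, B i + B (i+1) ≤ K := by
    intro i
    refine (add_le_add (hBs i) (hBs (i+1))).trans ?_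
    rw [← Finset.sum_add_distrib, hK, Finset.mul_sum]
    refine Finset.sum_le_sum fun v _ => ?_
    have e0 := hz v
    have e1 := ht1 v (i+1)
    have e2 := ht2 v i
    have e3 := ht1 v (i+1+1)
    have e4 := ht2 v (i+1)
    simp only [hw]
    split_ifs <;> rcases max_cases 0 (t i - t (i+1)) with h | h <;>
      rcases max_cases 0 (t (i+1) - t (i+1+1)) with h' | h' <;> linarith
  have hfirst : ∑ v, c v 0 + B 0 ≤ ∑ v, z v + m * t 0 := by
    refine (add_le_add le_rfl (hBs 0)).trans ?_
    have : m * t 0 = ∑ v : V, t 0 := by simp [hm]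
    rw [this, ← Finset.sum_add_distrib, ← Finset.sum_add_distrib]
    refine Finset.sum_le_sum fun v _ => ?_
    have e1 := ht1 v 0
    have e3 := ht1 v (0+1)
    simp only [hw]
    split_ifs <;> rcases max_cases 0 (t 0 - t (0+1)) with h | h <;> linarith
  have hM1 : ∀ n, pathM l (n+1) ≤ pathM l (n+2) := fun n => by
    rw [pathM]; exact le_max_left _ _
  have hM2 : ∀ n, pathM l n + l (n+1) ≤ pathM l (n+2) := fun n => by
    rw [pathM]; exact le_max_right _ _
  have hone : pathM l 1 = 1 := by simp [pathM, hl0]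
  have hzero : pathM l 0 = 0 := by simp [pathM]
  have key : ∀ n, 2 * m * (t 0 - t (n+1)) - 2 * B 0
      + (pathM l (n+2) - pathM l (n+1)) * B (n+1) ≤ (pathM l (n+2) - 1) * K := by
    intro n
    induction n with
    | zero =>
      have a1 := ha 1 le_rfl
      have h1 := mul_le_mul_of_nonneg_left (hBK 0) (sub_nonneg.2 (hM1 0))
      have h2 := mul_le_mul_of_nonneg_right (hM2 0) (hB0 0)
      have h3 : l 1 * B 0 = 2 * m * w 0 - B 0 := by
        simp only [hl1, hB]; field_simp
      have h4 := mul_le_mul_of_nonneg_left (hw1 0) hm0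
      simp only [zero_add, hone, hzero] at *
      linarith
    | succ k ih =>
      have a1 := ha (k+2) (by omega)
      have h1 := mul_le_mul_of_nonneg_left (hBK (k+1)) (sub_nonneg.2 (hM1 (k+1)))
      have h2 := mul_le_mul_of_nonneg_right (hM2 (k+1)) (hB0 (k+1))
      have h3 : l (k+2) * B (k+1) = 2 * m * w (k+1) := by
        simp only [hl2 (k+2) (by omega), hB]; field_simp
      have h4 := mul_le_mul_of_nonneg_left (hw1 (k+1)) hm0
      simp only [add_assoc, Nat.reduceAdd] at *
      linarith
  have h1 := key n
  have h2 := mul_nonneg (sub_nonneg.2 (hM1 n)) (hB0 (n+1))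
  rw [htn] at h1
  have h3 : (pathM l (n+2) - 1) * K = 2 * (pathM l (n+2) * ∑ v, z v) - 2 * ∑ v, z v := by
    rw [hK]; ring
  linarith


/-- Corollary (paths).  Distinct candidates `x 0, …, x (ℓ-1)`
(0-indexed version of `x_1, …, x_ℓ`); for each consecutive pair, at least an
`α j` fraction of the `m` voters prefer the earlier candidate to the later one.
With `λ` as defined (index `0` ↦ `1`, index `1` ↦ `2/α-1`, indices `≥ 2` ↦ `2/α`)
and `Λ` the maximum of `∑_{i ∈ S} λ i` over independent sets `S` (no two
consecutive indices), we have `cost (x 0) ≤ Λ * cost (x (ℓ-1))`. -/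
theorem stmt_1
    {V C : Type*} [Fintype V] [Nonempty V] [Fintype C]
    (P : V → C → C → Prop) (hP : ∀ v, IsStrictTotalOrder C (P v))
    (ℓ : ℕ) (hℓ : 2 ≤ ℓ)
    (x : Fin ℓ → C) (hx : Function.Injective x)
    (α : Fin ℓ → ℝ)
    (hα : ∀ i : Fin ℓ, 1 ≤ (i : ℕ) → 0 < α i ∧ α i ≤ 1)
    (hpref : ∀ i j : Fin ℓ, (i : ℕ) + 1 = (j : ℕ) →
      α j * (Fintype.card V : ℝ) ≤ (Nat.card {v : V // P v (x i) (x j)} : ℝ))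
    (lam : Fin ℓ → ℝ)
    (hlam : ∀ i : Fin ℓ, lam i =
      if (i : ℕ) = 0 then 1 else if (i : ℕ) = 1 then 2 / α i - 1 else 2 / α i)
    (Λ : ℝ)
    (hΛ : IsGreatest {s : ℝ | ∃ S : Finset (Fin ℓ),
      (∀ i ∈ S, ∀ j ∈ S, (i : ℕ) + 1 ≠ (j : ℕ)) ∧ s = ∑ i ∈ S, lam i} Λ)
    (d : V → C → ℝ)
    (hd0 : ∀ v y, 0 ≤ d v y)
    (htri : ∀ v v' y z, d v y ≤ d v z + d v' z + d v' y)
    (hcons : ∀ v y z, P v y z → d v y ≤ d v z) :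
    (∑ v, d v (x ⟨0, by omega⟩)) ≤ Λ * (∑ v, d v (x ⟨ℓ - 1, by omega⟩)) := by


  classical
  obtain ⟨n, rfl⟩ : ∃ n, ℓ = n + 2 := ⟨ℓ - 2, by omega⟩
  let f : ℕ → Fin (n+2) := fun i => ⟨min i (n+1), by omega⟩
  have hfv : ∀ i, (f i : ℕ) = min i (n+1) := fun i => rfl
  let z : V → ℝ := fun v => d v (x (f (n+1)))
  let c : V → ℕ → ℝ := fun v i => d v (x (f i))
  let a : ℕ → ℝ := fun i => α (f i)
  let l : ℕ → ℝ := fun i => if i = 0 then 1 else if i = 1 then 2 / a i - 1 else 2 / a i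
  let t : ℕ → ℝ := fun i => if n + 1 ≤ i then 0 else
    Finset.univ.inf' Finset.univ_nonempty (fun v => c v i + z v)
  have hflast : ∀ i, n + 1 ≤ i → f i = f (n+1) := fun i hi => by
    apply Fin.ext; rw [hfv, hfv]; omega
  have ha : ∀ i, 1 ≤ i → 0 < a i ∧ a i ≤ 1 := fun i hi =>
    hα (f i) (by rw [hfv]; omega)
  have hcore := path_core c z t a l (fun v => hd0 _ _) (fun i hi => (ha i hi).1)
    (by
      intro v i
      by_cases h : n + 1 ≤ i
      · simp only [t, if_pos h, c, z, hflast i h]; simp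
      · simp only [t, if_neg h]
        obtain ⟨v', -, hv'⟩ := Finset.exists_mem_eq_inf' (Finset.univ_nonempty (α := V))
          (fun v => c v i + z v)
        rw [hv']
        have := htri v v' (x (f i)) (x (f (n+1)))
        simp only [c, z]; linarith)
    (by
      intro v i
      by_cases h : n + 1 ≤ i
      · simp only [t, if_pos h]; exact add_nonneg (hd0 _ _) (hd0 _ _)
      · simp only [t, if_neg h]
        exact Finset.inf'_le (fun v => c v i + z v) (Finset.mem_univ v))
    (by
      intro i
      by_cases h : n + 1 ≤ i
      · have : ∀ v, c v i ≤ c v (i+1) := fun v => by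
          simp only [c, hflast i h, hflast (i+1) (by omega)]; exact le_rfl
        simp only [this, if_true]
        have h1 := (ha (i+1) (by omega)).2
        simp only [Finset.sum_const, Finset.card_univ, nsmul_eq_mul, mul_one]
        exact mul_le_of_le_one_left (by positivity) h1
      · refine (hpref (f i) (f (i+1)) (by rw [hfv, hfv]; omega)).trans ?_
        rw [Finset.sum_boole, Nat.card_eq_fintype_card, Fintype.card_subtype]
        exact_mod_cast Finset.card_le_card (fun v hv => by
          simp only [Finset.mem_filter, Finset.mem_univ, true_and] at hv ⊢
          exact hcons _ _ _ hv))
    (by simp [l]) (by simp [l])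
    (by intro i hi; simp only [l]; rw [if_neg (by omega), if_neg (by omega)])
    n (by simp [t])
  have hle : pathM l (n+2) ≤ Λ := by
    obtain ⟨S, h1, h2, h3⟩ := pathM_indep l (n+2)
    apply hΛ.2
    refine ⟨S.attachFin h1, ?_, ?_⟩
    · intro i hi j hj
      exact h2 _ (Finset.mem_attachFin h1 |>.1 hi) _ (Finset.mem_attachFin h1 |>.1 hj)
    · have hl : ∀ i : Fin (n+2), lam i = l i := fun i => by
        have : f (i : ℕ) = i := by apply Fin.ext; rw [hfv]; omega
        rw [hlam]; simp only [l, a, this]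
      rw [h3, Finset.sum_congr rfl (fun i _ => hl i)]
      have e := congrArg (fun T => ∑ i ∈ T, l i) (Finset.map_valEmbedding_attachFin h1)
      simp only [Finset.sum_map] at e
      exact e.symm
  have hf0 : f 0 = ⟨0, by omega⟩ := by apply Fin.ext; simp [hfv]
  have hf1 : f (n+1) = ⟨n+2-1, by omega⟩ := by apply Fin.ext; simp [hfv]
  have hz : 0 ≤ ∑ v, z v := Finset.sum_nonneg fun v _ => hd0 _ _
  have := hcore.trans (mul_le_mul_of_nonneg_right hle hz)
  simp only [c, z, hf0, hf1] at this
  exact this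
end

section
/- Let ℓ ≥ 2 be even, let α ∈ (0,1], and let x_1, x_2, …, x_ℓ be distinct candidates such that for each i = 2, …, ℓ, at least α·m voters v have x_{i-1} ≻_v x_i. Then for every pseudometric d consistent with the profile, cost(x_1) ≤ (ℓ/α − 1) · cost(x_ℓ). -/
open Classical in
theorem chain_count {V : Type*} [Fintype V] (Q : V → Prop) (r : ℝ)
    (h : r ≤ (Nat.card {v : V // Q v} : ℝ)) : r ≤ ∑ v, (if Q v then (1 : ℝ) else 0) := by
  refine h.trans (le_of_eq ?_)
  rw [Nat.card_eq_fintype_card, Fintype.card_subtype, Finset.sum_boole]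

open Classical in
theorem chain_pair {V : Type*} [Fintype V] (Q R : V → Prop) (r : ℝ) (hr : 0 ≤ r)
    (hQ : r ≤ (Nat.card {v : V // Q v} : ℝ)) (hR : r ≤ (Nat.card {v : V // R v} : ℝ))
    (f : V → ℝ) (hf : ∀ v, 0 ≤ f v) (g h : ℝ) (h1 : ∀ v, Q v → g ≤ 2 * f v)
    (h2 : ∀ v, R v → h ≤ 2 * f v) (h3 : ∀ v, Q v → R v → g + h ≤ 2 * f v) :
    r * (g + h) ≤ 2 * ∑ v, f v := by
  have key : (∑ v, (if Q v then (1 : ℝ) else 0)) * max g 0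
      + (∑ v, (if R v then (1 : ℝ) else 0)) * max h 0 ≤ 2 * ∑ v, f v := by
    rw [Finset.sum_mul, Finset.sum_mul, ← Finset.sum_add_distrib, Finset.mul_sum]
    refine Finset.sum_le_sum fun v _ => ?_
    have a0 := hf v
    have a1 := h1 v
    have a2 := h2 v
    have a3 := h3 v
    rcases max_cases g 0 with ⟨e, _⟩ | ⟨e, _⟩ <;> rcases max_cases h 0 with ⟨e', _⟩ | ⟨e', _⟩ <;>
      rw [e, e'] <;> by_cases q : Q v <;> by_cases s : R v <;> simp [q, s] at * <;> linarith
  have b1 := mul_le_mul_of_nonneg_right (chain_count Q r hQ) (le_max_right g 0)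
  have b2 := mul_le_mul_of_nonneg_right (chain_count R r hR) (le_max_right h 0)
  have b3 := mul_le_mul_of_nonneg_left (le_max_left g 0) hr
  have b4 := mul_le_mul_of_nonneg_left (le_max_left h 0) hr
  linarith

/-- Uniform-fraction chain bound, even length.
Distinct candidates `x 0, …, x (ℓ-1)` with `ℓ ≥ 2` even; for each consecutive
pair, at least `α·m` voters prefer the earlier candidate over the later one.
Then `cost (x 0) ≤ (ℓ/α − 1) · cost (x (ℓ-1))`. -/
theorem stmt_2
    {V C : Type*} [Fintype V] [Nonempty V] [Fintype C]
    (P : V → C → C → Prop) (hP : ∀ v, IsStrictTotalOrder C (P v))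
    (ℓ : ℕ) (hℓ : 2 ≤ ℓ) (heven : Even ℓ)
    (α : ℝ) (hα0 : 0 < α) (hα1 : α ≤ 1)
    (x : Fin ℓ → C) (hx : Function.Injective x)
    (hpref : ∀ i j : Fin ℓ, (i : ℕ) + 1 = (j : ℕ) →
      α * (Fintype.card V : ℝ) ≤ (Nat.card {v : V // P v (x i) (x j)} : ℝ))
    (d : V → C → ℝ)
    (hd0 : ∀ v y, 0 ≤ d v y)
    (htri : ∀ v v' y z, d v y ≤ d v z + d v' z + d v' y)
    (hcons : ∀ v y z, P v y z → d v y ≤ d v z) :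
    (∑ v, d v (x ⟨0, by omega⟩)) ≤
      ((ℓ : ℝ) / α - 1) * (∑ v, d v (x ⟨ℓ - 1, by omega⟩)) := by
  classical
  obtain ⟨n, hn⟩ := heven
  have bdd : ∀ y, ∃ t : ℝ, (∀ v, d v y ≤ d v (x ⟨ℓ - 1, by omega⟩) + t) ∧
      (∃ v, t = d v y - d v (x ⟨ℓ - 1, by omega⟩)) := by
    intro y
    obtain ⟨v, hv⟩ := Finite.exists_max (fun v => d v y - d v (x ⟨ℓ - 1, by omega⟩))
    exact ⟨_, fun w => by have := hv w; linarith, v, rfl⟩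
  generalize hb : x ⟨ℓ - 1, by omega⟩ = b at *
  generalize ha : x ⟨0, by omega⟩ = a at *
  choose t ht1 ht2 using bdd
  have htb : t b = 0 := by
    obtain ⟨v, hv⟩ := ht2 b
    linarith
  have ht3 : ∀ v y, t y ≤ d v y + d v b := by
    intro v y
    obtain ⟨w, hw⟩ := ht2 y
    have := htri w v y b
    linarith
  have hgap : ∀ v y z, P v y z → t y - t z ≤ 2 * d v b := by
    intro v y z h
    have := hcons v y z h
    have := ht3 v y
    have := ht1 z v
    linarith
  have hm : (0 : ℝ) < Fintype.card V := by exact_mod_cast Fintype.card_pos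
  set m : ℝ := (Fintype.card V : ℝ) with hmdef
  set c := ∑ v, d v b with hc
  have hc0 : 0 ≤ c := Finset.sum_nonneg fun v _ => hd0 v b
  have hr : 0 ≤ α * m := by positivity
  have hpair : ∀ i j k : Fin ℓ, (i : ℕ) + 1 = j → (j : ℕ) + 1 = k →
      α * m * (t (x i) - t (x k)) ≤ 2 * c := by
    intro i j k hij hjk
    have := chain_pair (fun v => P v (x i) (x j)) (fun v => P v (x j) (x k)) (α * m) hr
      (hpref i j hij) (hpref j k hjk) (fun v => d v b) (fun v => hd0 v b)
      (t (x i) - t (x j)) (t (x j) - t (x k)) (fun v h => hgap v _ _ h) (fun v h => hgap v _ _ h)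
      (fun v h h' => by
        have := hgap v _ _ ((hP v).toIsStrictOrder.toIsTrans.trans _ _ _ h h')
        linarith)
    calc _ = α * m * (t (x i) - t (x j) + (t (x j) - t (x k))) := by ring
      _ ≤ _ := this
  have hind : ∀ k : ℕ, ∀ hk : 1 + 2 * k < ℓ,
      α * m * (t (x ⟨1, by omega⟩) - t (x ⟨1 + 2 * k, hk⟩)) ≤ 2 * k * c := by
    intro k
    induction k with
    | zero => intro hk; simp
    | succ k ih =>
      intro hk
      have h1 := ih (by omega)
      have h2 := hpair ⟨1 + 2 * k, by omega⟩ ⟨1 + 2 * k + 1, by omega⟩ ⟨1 + 2 * (k + 1), hk⟩ rfl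
        (by simp; omega)
      push_cast
      nlinarith
  have h1 := hind (n - 1) (by omega)
  have e1 : (⟨1 + 2 * (n - 1), by omega⟩ : Fin ℓ) = ⟨ℓ - 1, by omega⟩ := by
    ext; simp; omega
  have e2 : (2 : ℝ) * ((n - 1 : ℕ) : ℝ) = ℓ - 2 := by
    rw [Nat.cast_sub (by omega), hn]; push_cast; ring
  rw [e1, hb, htb, e2] at h1
  have hp := hpref ⟨0, by omega⟩ ⟨1, by omega⟩ rfl
  rw [ha] at hp
  set y := x ⟨1, by omega⟩ with hy
  have h0 := chain_count _ _ hp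
  set s := ∑ v, (if P v a y then (1 : ℝ) else 0) with hs
  set g := max (t a - t y) 0 with hg
  have hg0 : 0 ≤ g := le_max_right _ _
  have hgt : t a ≤ t y + g := by linarith [le_max_left (t a - t y) 0]
  have hG : s * g ≤ 2 * c := by
    rw [hs, hc, Finset.sum_mul, Finset.mul_sum]
    refine Finset.sum_le_sum fun v _ => ?_
    have := hd0 v b
    split_ifs with h
    · rw [one_mul]
      exact max_le (hgap v _ _ h) (by linarith)
    · linarith
  have hA : ∑ v, d v a ≤ c + m * (t y + g) - s * g := by
    have : c + m * (t y + g) - s * g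
        = ∑ v, (d v b + (t y + g) - (if P v a y then (1 : ℝ) else 0) * g) := by
      rw [Finset.sum_sub_distrib, Finset.sum_add_distrib, ← Finset.sum_mul]
      simp [hmdef, hc, hs]
      ring
    rw [this]
    refine Finset.sum_le_sum fun v _ => ?_
    split_ifs with h
    · have := hcons v _ _ h
      have := ht1 y v
      linarith
    · have := ht1 a v
      linarith
  have hsg : α * m * g ≤ s * g := mul_le_mul_of_nonneg_right h0 hg0
  have hfin : α * ∑ v, d v a ≤ (ℓ - α) * c := by
    have e3 := mul_le_mul_of_nonneg_left hA hα0.le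
    have e4 := mul_le_mul_of_nonneg_left hsg hα0.le
    have e5 := mul_le_mul_of_nonneg_left (hsg.trans hG) (sub_nonneg.2 hα1)
    nlinarith
  have : ((ℓ : ℝ) / α - 1) * c = ((ℓ - α) * c) / α := by
    field_simp
  rw [this, le_div_iff₀ hα0]
  linarith
end

section
/- Let ℓ ≥ 3 be odd, let α ∈ (0,1], and let x_1, x_2, …, x_ℓ be distinct candidates such that for each i = 2, …, ℓ, at least α·m voters v have x_{i-1} ≻_v x_i. Then for every pseudometric d consistent with the profile, cost(x_1) ≤ ((ℓ−1)/α + 1) · cost(x_ℓ). -/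
lemma step_aux {V : Type*} [Fintype V] (S T : V → Prop) (c : V → ℝ) (a A B D : ℝ)
    (hc : ∀ v, 0 ≤ c v)
    (hS : a ≤ (Nat.card {v // S v} : ℝ)) (hT : a ≤ (Nat.card {v // T v} : ℝ))
    (h1 : ∀ v, T v → A - B ≤ 2 * c v) (h2 : ∀ v, S v → B - D ≤ 2 * c v)
    (h3 : ∀ v, S v → T v → A - D ≤ 2 * c v) (ha : 0 ≤ a) :
    a * (A - D) ≤ 2 * ∑ v, c v := by
  classical
  have hc0 : 0 ≤ ∑ v, c v := Finset.sum_nonneg fun v _ => hc v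
  by_cases hAD : A - D ≤ 0
  · nlinarith
  push Not at hAD
  obtain ⟨p, q, hp, hq, hpq, hpA, hqB⟩ : ∃ p q : ℝ, 0 ≤ p ∧ 0 ≤ q ∧ p + q = A - D ∧
      (p ≤ 0 ∨ p ≤ A - B) ∧ (q ≤ 0 ∨ q ≤ B - D) := by
    by_cases h : A - B ≤ 0
    · exact ⟨0, A - D, le_rfl, hAD.le, by ring, Or.inl le_rfl, Or.inr (by linarith)⟩
    · by_cases h' : B - D ≤ 0
      · exact ⟨A - D, 0, hAD.le, le_rfl, by ring, Or.inr (by linarith), Or.inl le_rfl⟩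
      · exact ⟨A - B, B - D, by linarith, by linarith, by ring, Or.inr le_rfl, Or.inr le_rfl⟩
  have key : ∀ v, p * (if T v then 1 else 0) + q * (if S v then 1 else 0) ≤ 2 * c v := by
    intro v
    have := hc v
    by_cases hv : T v <;> by_cases hw : S v <;> simp only [hv, hw, if_true, if_false]
    · linarith [h3 v hw hv]
    · have := h1 v hv
      rcases hpA with h | h <;> linarith
    · have := h2 v hw
      rcases hqB with h | h <;> linarith
    · linarith
  have hsum := Finset.sum_le_sum (s := Finset.univ) fun v _ => key v
  rw [Finset.sum_add_distrib, ← Finset.mul_sum, ← Finset.mul_sum, ← Finset.mul_sum,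
    Finset.sum_boole, Finset.sum_boole] at hsum
  rw [Nat.card_eq_fintype_card, Fintype.card_subtype] at hS hT
  have e1 := mul_le_mul_of_nonneg_left hT hp
  have e2 := mul_le_mul_of_nonneg_left hS hq
  rw [← hpq]
  linarith


/-- Uniform-fraction chain bound, odd length.
Distinct candidates `x 0, …, x (ℓ-1)` with `ℓ ≥ 3` odd; for each consecutive
pair, at least `α·m` voters prefer the earlier candidate over the later one.
Then `cost (x 0) ≤ ((ℓ−1)/α + 1) · cost (x (ℓ-1))`. -/
theorem stmt_3
    {V C : Type*} [Fintype V] [Nonempty V] [Fintype C]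
    (P : V → C → C → Prop) (hP : ∀ v, IsStrictTotalOrder C (P v))
    (ℓ : ℕ) (hℓ : 3 ≤ ℓ) (hodd : Odd ℓ)
    (α : ℝ) (hα0 : 0 < α) (hα1 : α ≤ 1)
    (x : Fin ℓ → C) (hx : Function.Injective x)
    (hpref : ∀ i j : Fin ℓ, (i : ℕ) + 1 = (j : ℕ) →
      α * (Fintype.card V : ℝ) ≤ (Nat.card {v : V // P v (x i) (x j)} : ℝ))
    (d : V → C → ℝ)
    (hd0 : ∀ v y, 0 ≤ d v y)
    (htri : ∀ v v' y z, d v y ≤ d v z + d v' z + d v' y)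
    (hcons : ∀ v y z, P v y z → d v y ≤ d v z) :
    (∑ v, d v (x ⟨0, by omega⟩)) ≤
      (((ℓ : ℝ) - 1) / α + 1) * (∑ v, d v (x ⟨ℓ - 1, by omega⟩)) := by
  classical
  obtain ⟨n, hn⟩ := hodd
  set y : C := x ⟨ℓ - 1, by omega⟩ with hy
  have hex : ∀ z : C, ∃ e : ℝ, (∀ v, d v z ≤ d v y + e) ∧ (∀ v, e ≤ d v z + d v y) := by
    intro z
    obtain ⟨w, hw⟩ := Finite.exists_min (fun v => d v z + d v y)
    refine ⟨d w z + d w y, fun v => ?_, hw⟩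
    have := htri v w z y
    linarith
  have hex2 : ∀ z : C, ∃ e : ℝ, ((∀ v, d v z ≤ d v y + e) ∧ (∀ v, e ≤ d v z + d v y)) ∧
      (z = y → e = 0) := by
    intro z
    by_cases hz : z = y
    · refine ⟨0, ⟨fun v => by rw [hz]; simp, fun v => ?_⟩, fun _ => rfl⟩
      linarith [hd0 v z, hd0 v y]
    · obtain ⟨e, he⟩ := hex z
      exact ⟨e, he, fun h => absurd h hz⟩
  choose e he he0 using hex2
  have ha : 0 ≤ α * (Fintype.card V : ℝ) := by positivity
  have main : ∀ k : ℕ, ∀ hk : 2 * k < ℓ,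
      α * (Fintype.card V : ℝ) * e (x ⟨ℓ - 1 - 2 * k, by omega⟩) ≤ 2 * k * ∑ v, d v y := by
    intro k
    induction k with
    | zero =>
      intro hk
      have : e (x ⟨ℓ - 1 - 2 * 0, by omega⟩) = 0 := he0 _ rfl
      rw [this]; simp
    | succ k ih =>
      intro hk
      have ih' := ih (by omega)
      have hst : ∀ i j l : Fin ℓ, (i : ℕ) + 1 = j → (j : ℕ) + 1 = l →
          α * (Fintype.card V : ℝ) * (e (x i) - e (x l)) ≤ 2 * ∑ v, d v y := by
        intro i j l hij hjl
        refine step_aux (fun v => P v (x j) (x l)) (fun v => P v (x i) (x j))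
          (fun v => d v y) _ _ (e (x j)) _ (fun v => hd0 v y) (hpref j l hjl) (hpref i j hij)
          (fun v hv => ?_) (fun v hv => ?_) (fun v hv hw => ?_) ha
        · linarith [hcons _ _ _ hv, (he (x i)).2 v, (he (x j)).1 v]
        · linarith [hcons _ _ _ hv, (he (x j)).2 v, (he (x l)).1 v]
        · linarith [hcons _ _ _ hv, hcons _ _ _ hw, (he (x i)).2 v, (he (x l)).1 v]
      have hst' := hst ⟨ℓ - 1 - 2 * (k + 1), by omega⟩ ⟨ℓ - 1 - (2 * k + 1), by omega⟩
        ⟨ℓ - 1 - 2 * k, by omega⟩ (by simp only; omega) (by simp only; omega)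
      rw [mul_sub] at hst'
      rw [Nat.cast_succ]
      linarith
  have hm := main n (by omega)
  have hidx : (⟨ℓ - 1 - 2 * n, by omega⟩ : Fin ℓ) = ⟨0, by omega⟩ := by
    apply Fin.ext; simp only; omega
  rw [hidx] at hm
  set z := x ⟨0, by omega⟩
  have h1 : ∑ v, d v z ≤ ∑ v, (d v y + e z) := Finset.sum_le_sum fun v _ => (he z).1 v
  rw [Finset.sum_add_distrib, Finset.sum_const, nsmul_eq_mul, Finset.card_univ] at h1
  have hl : (ℓ : ℝ) - 1 = 2 * n := by rw [hn]; push_cast; ring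
  have h2 : (Fintype.card V : ℝ) * e z ≤ 2 * n / α * ∑ v, d v y := by
    rw [div_mul_eq_mul_div, le_div_iff₀ hα0]
    linarith
  rw [hl]
  linarith
end

section
/- Let ℓ ≥ 2 and let x_1, x_2, …, x_ℓ be distinct candidates such that for each i = 2, …, ℓ, at least m/2 voters v have x_{i-1} ≻_v x_i. Then for every pseudometric d consistent with the profile, cost(x_1) ≤ (2ℓ − 1) · cost(x_ℓ). -/
/-- One step of the chain: passing from `b` to `a` costs at most `2 · cost y`. -/
theorem chain_step {V C : Type*} [Fintype V] (R : V → C → C → Prop) (d : V → C → ℝ)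
    (hd0 : ∀ v y, 0 ≤ d v y)
    (htri : ∀ v v' y z, d v y ≤ d v z + d v' z + d v' y)
    (hcons : ∀ v y z, R v y z → d v y ≤ d v z) (a b y : C)
    (h : (Fintype.card V : ℝ) / 2 ≤ (Nat.card {v : V // R v a b} : ℝ)) :
    ∑ v, d v a ≤ ∑ v, d v b + 2 * ∑ v, d v y := by
  classical
  rw [Nat.card_eq_fintype_card] at h
  have hc : Fintype.card {v : V // ¬ R v a b} ≤ Fintype.card {v : V // R v a b} := by
    have h1 := Fintype.card_subtype_compl (fun v : V => R v a b)
    have h2 : (Fintype.card V : ℝ) ≤ ((2 * Fintype.card {v : V // R v a b} : ℕ) : ℝ) := by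
      push_cast; linarith
    have h3 := Nat.cast_le.mp h2
    omega
  obtain ⟨f⟩ := Function.Embedding.nonempty_of_card_le hc
  have split : ∀ g : V → ℝ, ∑ v, g v =
      ∑ v : {v : V // R v a b}, g v + ∑ v : {v : V // ¬ R v a b}, g v := fun g =>
    (Fintype.sum_subtype_add_sum_subtype (fun v : V => R v a b) g).symm
  have hA : ∑ v : {v : V // R v a b}, d v a ≤ ∑ v : {v : V // R v a b}, d v b :=
    Finset.sum_le_sum fun v _ => hcons v a b v.2
  have hB : ∑ v : {v : V // ¬ R v a b}, d v a ≤
      ∑ v : {v : V // ¬ R v a b}, (d v b + 2 * d v y + 2 * d (f v) y) :=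
    Finset.sum_le_sum fun v _ => by
      have h1 := htri v (f v) a y
      have h2 := hcons (f v) a b (f v).2
      have h3 := htri (f v) v b y
      linarith
  have hF : ∑ v : {v : V // ¬ R v a b}, d (f v) y ≤ ∑ v : {v : V // R v a b}, d v y := by
    rw [← Finset.sum_map Finset.univ f (fun v : {v : V // R v a b} => d v y)]
    exact Finset.sum_le_sum_of_subset_of_nonneg (Finset.subset_univ _) fun v _ _ => hd0 v y
  simp only [Finset.sum_add_distrib, ← Finset.mul_sum] at hB
  rw [split (fun v => d v a), split (fun v => d v b), split (fun v => d v y)]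
  linarith

/-- Majority chain bound.
Distinct candidates `x 0, …, x (ℓ-1)` with `ℓ ≥ 2`; for each consecutive pair,
at least `m/2` voters prefer the earlier candidate over the later one.
Then `cost (x 0) ≤ (2ℓ − 1) · cost (x (ℓ-1))`. -/
theorem stmt_4
    {V C : Type*} [Fintype V] [Nonempty V] [Fintype C]
    (P : V → C → C → Prop) (hP : ∀ v, IsStrictTotalOrder C (P v))
    (ℓ : ℕ) (hℓ : 2 ≤ ℓ)
    (x : Fin ℓ → C) (hx : Function.Injective x)
    (hpref : ∀ i j : Fin ℓ, (i : ℕ) + 1 = (j : ℕ) →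
      (Fintype.card V : ℝ) / 2 ≤ (Nat.card {v : V // P v (x i) (x j)} : ℝ))
    (d : V → C → ℝ)
    (hd0 : ∀ v y, 0 ≤ d v y)
    (htri : ∀ v v' y z, d v y ≤ d v z + d v' z + d v' y)
    (hcons : ∀ v y z, P v y z → d v y ≤ d v z) :
    (∑ v, d v (x ⟨0, by omega⟩)) ≤
      (2 * (ℓ : ℝ) - 1) * (∑ v, d v (x ⟨ℓ - 1, by omega⟩)) := by
  have key : ∀ k : ℕ, ∀ hk : k < ℓ, ∑ v, d v (x ⟨0, by omega⟩) ≤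
      ∑ v, d v (x ⟨k, hk⟩) + 2 * (k : ℝ) * ∑ v, d v (x ⟨ℓ - 1, by omega⟩) := by
    intro k
    induction k with
    | zero => intro hk; simp
    | succ k ih =>
      intro hk
      have h1 := ih (by omega)
      have h2 := chain_step P d hd0 htri hcons (x ⟨k, by omega⟩) (x ⟨k + 1, hk⟩)
        (x ⟨ℓ - 1, by omega⟩) (hpref _ _ rfl)
      push_cast
      linarith
  have h := key (ℓ - 1) (by omega)
  rw [Nat.cast_sub (by omega)] at h
  push_cast at h
  linarith
end

section
/- Let x, y, z be three distinct candidates such that at least m/2 voters v have x ≻_v y and at least m/2 voters v have y ≻_v z. Then for every pseudometric d consistent with the profile, cost(x) ≤ 5 · cost(z). -/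
/-- The distance between two candidates, realised as a minimum over the voters. -/
lemma exists_cand_dist {V C : Type*} [Fintype V] [Nonempty V] (d : V → C → ℝ)
    (hd0 : ∀ v a, 0 ≤ d v a)
    (htri : ∀ v v' a b, d v a ≤ d v b + d v' b + d v' a) (p q : C) :
    ∃ a : ℝ, 0 ≤ a ∧ (∀ v, a ≤ d v p + d v q) ∧ (∀ v, d v p ≤ d v q + a) := by
  obtain ⟨w, hw⟩ := Finite.exists_min (fun v => d v p + d v q)
  refine ⟨d w p + d w q, add_nonneg (hd0 _ _) (hd0 _ _), hw, fun v => ?_⟩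
  linarith [htri v w p q]

lemma sum_ind_nonneg {V : Type*} [Fintype V] (Q : V → Prop) [DecidablePred Q]
    (h : (Fintype.card V : ℝ) / 2 ≤ (Nat.card {v : V // Q v} : ℝ)) :
    0 ≤ ∑ v, ((if Q v then (1 : ℝ) else 0) - 1 / 2) := by
  rw [Finset.sum_sub_distrib, Finset.sum_boole, Finset.sum_const, Finset.card_univ]
  rw [Nat.card_eq_fintype_card, Fintype.card_subtype] at h
  simp only [nsmul_eq_mul]
  linarith

/-- If at least half the voters prefer `x` to `y` and at least half
prefer `y` to `z` (for distinct candidates `x, y, z`), then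
`cost x ≤ 5 · cost z` for every consistent pseudometric. -/
theorem stmt_5
    {V C : Type*} [Fintype V] [Nonempty V] [Fintype C]
    (P : V → C → C → Prop) (hP : ∀ v, IsStrictTotalOrder C (P v))
    (x y z : C) (hxy : x ≠ y) (hyz : y ≠ z) (hxz : x ≠ z)
    (hxy2 : (Fintype.card V : ℝ) / 2 ≤ (Nat.card {v : V // P v x y} : ℝ))
    (hyz2 : (Fintype.card V : ℝ) / 2 ≤ (Nat.card {v : V // P v y z} : ℝ))
    (d : V → C → ℝ)
    (hd0 : ∀ v a, 0 ≤ d v a)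
    (htri : ∀ v v' a b, d v a ≤ d v b + d v' b + d v' a)
    (hcons : ∀ v a b, P v a b → d v a ≤ d v b) :
    (∑ v, d v x) ≤ 5 * (∑ v, d v z) := by
  classical
  obtain ⟨a, ha0, ha1, ha2⟩ := exists_cand_dist d hd0 htri x z
  obtain ⟨b, hb0, hb1, hb2⟩ := exists_cand_dist d hd0 htri y z
  have hA := sum_ind_nonneg (fun v => P v x y) hxy2
  have hB := sum_ind_nonneg (fun v => P v y z) hyz2
  have key : 0 ≤ ∑ v, (5 * d v z - d v x) := by
    rcases le_total a b with hab | hab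
    · have h1 : ∑ v, 2 * b * ((if P v y z then (1 : ℝ) else 0) - 1 / 2)
          ≤ ∑ v, (5 * d v z - d v x) := by
        refine Finset.sum_le_sum fun v _ => ?_
        have := ha2 v
        have := hb1 v
        have := hd0 v z
        have h2 := hcons v y z
        split_ifs with h
        · have := h2 h
          linarith
        · linarith
      rw [← Finset.mul_sum] at h1
      exact (mul_nonneg (by linarith) hB).trans h1
    · have h1 : ∑ v, ((3 * a - 2 * b) * ((if P v x y then (1 : ℝ) else 0) - 1 / 2)
          + 3 * b * ((if P v y z then (1 : ℝ) else 0) - 1 / 2))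
          ≤ ∑ v, (5 * d v z - d v x) := by
        refine Finset.sum_le_sum fun v _ => ?_
        have := ha1 v
        have := ha2 v
        have := hb1 v
        have := hb2 v
        have := hd0 v z
        have h2 := hcons v y z
        have h3 := hcons v x y
        split_ifs with h h' h'
        · have := h2 h'
          have := h3 h
          linarith
        · have := h3 h
          linarith
        · have := h2 h'
          linarith
        · linarith
      rw [Finset.sum_add_distrib, ← Finset.mul_sum, ← Finset.mul_sum] at h1
      exact (add_nonneg (mul_nonneg (by linarith) hA) (mul_nonneg (by linarith) hB)).trans h1
  rw [Finset.sum_sub_distrib, ← Finset.mul_sum] at key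
  linarith
end

section
/- Let x, y, z be three distinct candidates such that at least ((3 − √5)/2)·m voters v have x ≻_v y and at least ((√5 − 1)/2)·m voters v have y ≻_v z. Then for every pseudometric d consistent with the profile, cost(x) ≤ (2 + √5) · cost(z). -/
/-- If at least a `(3 − √5)/2` fraction of voters prefer `x` to `y`
and at least a `(√5 − 1)/2` fraction prefer `y` to `z` (for distinct
candidates `x, y, z`), then `cost x ≤ (2 + √5) · cost z` for every consistent
pseudometric. -/
theorem stmt_6
    {V C : Type*} [Fintype V] [Nonempty V] [Fintype C]
    (P : V → C → C → Prop) (hP : ∀ v, IsStrictTotalOrder C (P v))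
    (x y z : C) (hxy : x ≠ y) (hyz : y ≠ z) (hxz : x ≠ z)
    (hxy2 : ((3 - Real.sqrt 5) / 2) * (Fintype.card V : ℝ)
      ≤ (Nat.card {v : V // P v x y} : ℝ))
    (hyz2 : ((Real.sqrt 5 - 1) / 2) * (Fintype.card V : ℝ)
      ≤ (Nat.card {v : V // P v y z} : ℝ))
    (d : V → C → ℝ)
    (hd0 : ∀ v a, 0 ≤ d v a)
    (htri : ∀ v v' a b, d v a ≤ d v b + d v' b + d v' a)
    (hcons : ∀ v a b, P v a b → d v a ≤ d v b) :
    (∑ v, d v x) ≤ (2 + Real.sqrt 5) * (∑ v, d v z) := by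
  classical
  have hcard : ∀ Q : V → Prop, (Nat.card {v : V // Q v} : ℝ) = ∑ v, if Q v then (1 : ℝ) else 0 := by
    intro Q
    rw [Nat.card_eq_fintype_card, Fintype.card_subtype]
    simp
  have hdist : ∀ a : C, ∃ D : ℝ, 0 ≤ D ∧ (∀ v, d v a ≤ d v z + D) ∧ ∀ v, D ≤ d v a + d v z := by
    intro a
    obtain ⟨w, hw⟩ := Finite.exists_min (fun v => d v a + d v z)
    refine ⟨d w a + d w z, add_nonneg (hd0 _ _) (hd0 _ _), fun v => ?_, hw⟩
    linarith [htri v w a z]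
  obtain ⟨D, hD0, hD1, hD2⟩ := hdist x
  obtain ⟨E, hE0, hE1, hE2⟩ := hdist y
  rw [hcard] at hxy2 hyz2
  have h5 : Real.sqrt 5 ^ 2 = 5 := Real.sq_sqrt (by norm_num)
  have h5l : 2 < Real.sqrt 5 := by
    rw [Real.lt_sqrt] <;> norm_num
  obtain ⟨φ, hφ⟩ : ∃ φ : ℝ, φ = (Real.sqrt 5 - 1) / 2 := ⟨_, rfl⟩
  have hs : Real.sqrt 5 = 2 * φ + 1 := by linarith
  have hφ0 : 0 < φ := by linarith
  have hφ2 : φ ^ 2 = 1 - φ := by rw [hs] at h5; linarith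
  rw [← hφ] at hyz2
  rw [show (3 - Real.sqrt 5) / 2 = 1 - φ by linarith] at hxy2
  set A : ℝ := ∑ v, if P v x y then (1 : ℝ) else 0 with hA
  set B : ℝ := ∑ v, if P v y z then (1 : ℝ) else 0 with hB
  set m : ℝ := (Fintype.card V : ℝ) with hm
  -- it suffices to prove the inequality multiplied by `φ`
  have key : φ * (∑ v, d v x) - (φ + 2) * (∑ v, d v z) ≤ 0 := by
    rcases le_total D E with hDE | hDE
    · have hpt : ∀ v, φ * d v x - (φ + 2) * d v z ≤ φ * D - D * (if P v y z then (1 : ℝ) else 0) := by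
        intro v
        have h1 := mul_le_mul_of_nonneg_left (hD1 v) hφ0.le
        have h2 := hd0 v z
        split_ifs with h
        · have := hcons v y z h
          have := hE2 v
          linarith
        · linarith
      have hsum := Finset.sum_le_sum (fun v (_ : v ∈ Finset.univ) => hpt v)
      simp only [Finset.sum_sub_distrib, ← Finset.mul_sum, Finset.sum_const, Finset.card_univ,
        nsmul_eq_mul] at hsum
      rw [← hB, ← hm] at hsum
      nlinarith [mul_le_mul_of_nonneg_left hyz2 hD0]
    · have hpt : ∀ v, φ * d v x - (φ + 2) * d v z ≤
          φ * D - ((1 + φ) * (D - E)) * (if P v x y then (1 : ℝ) else 0)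
            - E * (if P v y z then (1 : ℝ) else 0) := by
        intro v
        have h1 := mul_le_mul_of_nonneg_left (hD1 v) hφ0.le
        have h2 := hd0 v z
        have h3 := hD2 v
        have h4 := hE2 v
        have h6 := mul_nonneg hφ0.le hE0
        split_ifs with ha hb hb
        · have h7 := hcons v x y ha
          have h8 := hcons v y z hb
          have h9 := mul_le_mul_of_nonneg_left (h7.trans h8) hφ0.le
          linarith
        · have h7 := hcons v x y ha
          have h9 := mul_le_mul_of_nonneg_left (h7.trans (hE1 v)) hφ0.le
          linarith [hE1 v]
        · have h8 := hcons v y z hb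
          linarith
        · linarith
      have hsum := Finset.sum_le_sum (fun v (_ : v ∈ Finset.univ) => hpt v)
      simp only [Finset.sum_sub_distrib, ← Finset.mul_sum, Finset.sum_const, Finset.card_univ,
        nsmul_eq_mul] at hsum
      rw [← hA, ← hB, ← hm] at hsum
      have hc : 0 ≤ (1 + φ) * (D - E) := mul_nonneg (by linarith) (by linarith)
      have e1 := mul_le_mul_of_nonneg_left hxy2 hc
      have e2 := mul_le_mul_of_nonneg_left hyz2 hE0
      have e3 : (1 + φ) * (D - E) * ((1 - φ) * m) = φ * (D - E) * m := by
        linear_combination (-(D - E) * m) * hφ2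
      linarith
  have hmul : φ * (∑ v, d v x) ≤ φ * ((2 + Real.sqrt 5) * (∑ v, d v z)) := by
    have : φ * ((2 + Real.sqrt 5) * (∑ v, d v z)) = (φ + 2) * (∑ v, d v z) := by
      rw [hs]
      linear_combination (2 * (∑ v, d v z)) * hφ2
    linarith
  exact le_of_mul_le_mul_left hmul hφ0
end

section
/- Let x ≠ y be candidates and let α ∈ (0,1] be such that at least α·m voters v have x ≻_v y. Then for every pseudometric d consistent with the profile, cost(x) ≤ (2/α − 1) · cost(y). -/
/-- If at least an `α` fraction of voters prefer `x` to `y`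
(`x ≠ y`, `α ∈ (0,1]`), then `cost x ≤ (2/α − 1) · cost y` for every
consistent pseudometric. -/
theorem stmt_7
    {V C : Type*} [Fintype V] [Nonempty V] [Fintype C]
    (P : V → C → C → Prop) (hP : ∀ v, IsStrictTotalOrder C (P v))
    (x y : C) (hxy : x ≠ y)
    (α : ℝ) (hα0 : 0 < α) (hα1 : α ≤ 1)
    (hpref : α * (Fintype.card V : ℝ) ≤ (Nat.card {v : V // P v x y} : ℝ))
    (d : V → C → ℝ)
    (hd0 : ∀ v a, 0 ≤ d v a)
    (htri : ∀ v v' a b, d v a ≤ d v b + d v' b + d v' a)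
    (hcons : ∀ v a b, P v a b → d v a ≤ d v b) :
    (∑ v, d v x) ≤ (2 / α - 1) * (∑ v, d v y) := by
  classical
  set S : Finset V := Finset.univ.filter (fun v => P v x y) with hS
  have hcard : (Nat.card {v : V // P v x y} : ℝ) = (S.card : ℝ) := by
    rw [Nat.card_eq_fintype_card, Fintype.card_subtype]
  rw [hcard] at hpref
  have hm : (0 : ℝ) < (Fintype.card V : ℝ) := by exact_mod_cast Fintype.card_pos
  have hs : (0 : ℝ) < (S.card : ℝ) := lt_of_lt_of_le (mul_pos hα0 hm) hpref
  have hne : S.Nonempty := Finset.card_pos.mp (by exact_mod_cast hs)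
  obtain ⟨w, hw, hmin⟩ := S.exists_min_image (fun v => d v y) hne
  have hwP : P w x y := by simpa [hS] using hw
  have ht : 0 ≤ d w y := hd0 w y
  have hpt : ∀ v, d v x ≤ d v y + (2 * d w y - if P v x y then 2 * d w y else 0) := by
    intro v
    split_ifs with h
    · linarith [hcons v x y h]
    · linarith [htri v w x y, hcons w x y hwP]
  have h1 : ∑ v, d v x ≤ ∑ v, d v y
      + ((Fintype.card V : ℝ) * (2 * d w y) - (S.card : ℝ) * (2 * d w y)) := by
    refine (Finset.sum_le_sum (fun v _ => hpt v)).trans (le_of_eq ?_)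
    rw [Finset.sum_add_distrib, Finset.sum_sub_distrib, ← Finset.sum_filter]
    simp [hS]
  have h2 : (S.card : ℝ) * d w y ≤ ∑ v, d v y := by
    calc (S.card : ℝ) * d w y = ∑ v ∈ S, d w y := by simp
      _ ≤ ∑ v ∈ S, d v y := Finset.sum_le_sum (fun v hv => hmin v hv)
      _ ≤ ∑ v, d v y :=
        Finset.sum_le_sum_of_subset_of_nonneg (Finset.subset_univ _) (fun v _ _ => hd0 v y)
  have h3 := mul_le_mul_of_nonneg_right hpref ht
  generalize (∑ v, d v y) = Y at *
  generalize (∑ v, d v x) = X at *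
  generalize (Fintype.card V : ℝ) = m at *
  generalize (S.card : ℝ) = s at *
  generalize d w y = t at *
  have h4 : (m * t) ≤ Y / α := by
    rw [le_div_iff₀ hα0]; linarith
  have h5 : (1 - α) * (m * t) ≤ (1 - α) * (Y / α) :=
    mul_le_mul_of_nonneg_left h4 (by linarith)
  have h6 : (1 - α) * (Y / α) = Y / α - Y := by field_simp
  have h7 : (2 / α - 1) * Y = 2 * (Y / α) - Y := by ring
  rw [h7]
  linarith
end

section
/- Let ℓ ≥ 2, let p ∈ [0,1], and let λ ≥ 1 be an integer with λ·(1 − p) ≤ 1/2. Let x_1, x_2, …, x_ℓ be distinct candidates such that for each i = 1, …, ℓ−1, at least p·m voters v have x_i ≻_v x_{i+1}. Then for every pseudometric d consistent with the profile, cost(x_1) ≤ (2·⌈(ℓ−1)/λ⌉ + 1) · cost(x_ℓ). -/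
open Classical in
/-- Voters at least as close to `a` as to `b`. -/
noncomputable def closer {V C : Type*} [Fintype V] (d : V → C → ℝ) (a b : C) : Finset V :=
  Finset.univ.filter (fun v => d v a ≤ d v b)

lemma mem_closer {V C : Type*} [Fintype V] (d : V → C → ℝ) (a b : C) (v : V) :
    v ∈ closer d a b ↔ d v a ≤ d v b := by
  simp [closer]

lemma bound_step {V C : Type*} (d : V → C → ℝ)
    (htri : ∀ v v' a b, d v a ≤ d v b + d v' b + d v' a)
    (o y : C) (r : ℝ) (v : V) (h : d v y ≤ d v o + r) (w : V) :
    d w y ≤ d w o + (r + 2 * d v o) := by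
  have := htri w v y o
  linarith

lemma two_step {V C : Type*} [Fintype V] [Nonempty V] (d : V → C → ℝ)
    (hd0 : ∀ v a, 0 ≤ d v a)
    (htri : ∀ v v' a b, d v a ≤ d v b + d v' b + d v' a)
    (o a b c : C) (r : ℝ)
    (hab : (Fintype.card V : ℝ) / 2 ≤ ((closer d a b).card : ℝ))
    (hbc : (Fintype.card V : ℝ) / 2 ≤ ((closer d b c).card : ℝ))
    (hr : ∀ v, d v c ≤ d v o + r) :
    ∃ r', Fintype.card V * r' ≤ Fintype.card V * r + 4 * (∑ v, d v o) ∧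
      ∀ v, d v a ≤ d v o + r' := by
  classical
  have hm : (0 : ℝ) < Fintype.card V := by exact_mod_cast Fintype.card_pos
  set m : ℝ := (Fintype.card V : ℝ) with hmdef
  set K : ℝ := ∑ v, d v o with hK
  by_cases hI : ∃ v ∈ closer d a b ∩ closer d b c, m * d v o ≤ 2 * K
  · obtain ⟨v, hv, hvK⟩ := hI
    rw [Finset.mem_inter, mem_closer, mem_closer] at hv
    refine ⟨r + 2 * d v o, by nlinarith, fun w => ?_⟩
    exact bound_step d htri o a r v (by have := hr v; linarith [hv.1, hv.2]) w
  · push Not at hI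
    have hne1 : (closer d a b).Nonempty := by
      rw [← Finset.card_pos]
      have : (0 : ℝ) < ((closer d a b).card : ℝ) := by linarith
      exact_mod_cast this
    have hne2 : (closer d b c).Nonempty := by
      rw [← Finset.card_pos]
      have : (0 : ℝ) < ((closer d b c).card : ℝ) := by linarith
      exact_mod_cast this
    obtain ⟨u, hu, humin⟩ := Finset.exists_min_image (closer d a b) (fun v => d v o) hne1
    obtain ⟨w, hw, hwmin⟩ := Finset.exists_min_image (closer d b c) (fun v => d v o) hne2
    rw [mem_closer] at hu hw
    have h1 : ∀ v, d v b ≤ d v o + (r + 2 * d w o) :=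
      bound_step d htri o b r w (by have := hr w; linarith)
    have h2 : ∀ v, d v a ≤ d v o + (r + 2 * d w o + 2 * d u o) :=
      bound_step d htri o a _ u (by have := h1 u; linarith)
    refine ⟨_, ?_, h2⟩
    by_contra hcon
    have he : 0 < m * d u o + m * d w o - 2 * K := by nlinarith
    set I := closer d a b ∩ closer d b c with hIdef
    -- sum over the intersection
    have hsumI : m * ∑ v ∈ I, d v o ≤ m * K := by
      apply mul_le_mul_of_nonneg_left _ hm.le
      exact Finset.sum_le_sum_of_subset_of_nonneg (Finset.subset_univ _) (fun v _ _ => hd0 v o)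
    rcases le_or_gt (m / 2) (I.card : ℝ) with hc | hc
    · have hneI : I.Nonempty := by
        rw [← Finset.card_pos]
        have : (0 : ℝ) < (I.card : ℝ) := by linarith
        exact_mod_cast this
      have h3 : ∑ v ∈ I, 2 * K < ∑ v ∈ I, m * d v o :=
        Finset.sum_lt_sum_of_nonempty hneI hI
      rw [Finset.sum_const, nsmul_eq_mul, ← Finset.mul_sum] at h3
      have hK0 : 0 ≤ K := Finset.sum_nonneg (fun v _ => hd0 v o)
      nlinarith
    · have h4 : ∀ v : V, (if v ∈ closer d a b then m * d u o else 0)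
          + (if v ∈ closer d b c then m * d w o else 0)
          - (if v ∈ I then m * d u o + m * d w o - 2 * K else 0) ≤ m * d v o := by
        intro v
        have hv0 := mul_nonneg hm.le (hd0 v o)
        by_cases hv1 : v ∈ closer d a b <;> by_cases hv2 : v ∈ closer d b c
        · have hv : v ∈ I := Finset.mem_inter.2 ⟨hv1, hv2⟩
          have := hI v hv
          simp only [hv1, hv2, hv, if_true]
          linarith
        · have hv : v ∉ I := fun h => hv2 (Finset.mem_inter.1 h).2
          have := mul_le_mul_of_nonneg_left (humin v hv1) hm.le
          simp only [hv1, hv2, hv, if_true, if_false]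
          linarith
        · have hv : v ∉ I := fun h => hv1 (Finset.mem_inter.1 h).1
          have := mul_le_mul_of_nonneg_left (hwmin v hv2) hm.le
          simp only [hv1, hv2, hv, if_true, if_false]
          linarith
        · have hv : v ∉ I := fun h => hv1 (Finset.mem_inter.1 h).1
          simp only [hv1, hv2, hv, if_false]
          linarith
      have h5 := Finset.sum_le_sum (fun v (_ : v ∈ Finset.univ) => h4 v)
      rw [Finset.sum_sub_distrib, Finset.sum_add_distrib, ← Finset.mul_sum] at h5
      simp only [Finset.sum_ite_mem, Finset.univ_inter, Finset.sum_const, nsmul_eq_mul] at h5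
      have h6 := mul_le_mul_of_nonneg_right hab (mul_nonneg hm.le (hd0 u o))
      have h7 := mul_le_mul_of_nonneg_right hbc (mul_nonneg hm.le (hd0 w o))
      have h8 := mul_lt_mul_of_pos_right hc he
      nlinarith

lemma even_chain {V C : Type*} [Fintype V] [Nonempty V] (d : V → C → ℝ)
    (hd0 : ∀ v a, 0 ≤ d v a)
    (htri : ∀ v v' a b, d v a ≤ d v b + d v' b + d v' a)
    (o : C) (n : ℕ) : ∀ (y : ℕ → C),
    (∀ i, (Fintype.card V : ℝ) / 2 ≤ ((closer d (y i) (y (i+1))).card : ℝ)) →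
    y (2 * n) = o →
    ∃ r, Fintype.card V * r ≤ 4 * n * (∑ v, d v o) ∧ ∀ v, d v (y 0) ≤ d v o + r := by
  induction n with
  | zero =>
    intro y _ hy
    refine ⟨0, by simp, fun v => ?_⟩
    have : y 0 = o := by simpa using hy
    rw [this]; simp
  | succ n ih =>
    intro y hmaj hy
    obtain ⟨r, hr, hb⟩ := ih (fun i => y (i + 2)) (fun i => by
      have := hmaj (i + 2)
      rwa [show i + 2 + 1 = i + 1 + 2 by ring] at this) (by
        show y (2 * n + 2) = o
        rw [← hy]; ring_nf)
    obtain ⟨r', hr', hb'⟩ := two_step d hd0 htri o (y 0) (y 1) (y 2) r (hmaj 0) (hmaj 1) hb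
    refine ⟨r', ?_, hb'⟩
    push_cast
    linarith

lemma last_step {V C : Type*} [Fintype V] [Nonempty V] (d : V → C → ℝ)
    (hd0 : ∀ v a, 0 ≤ d v a)
    (htri : ∀ v v' a b, d v a ≤ d v b + d v' b + d v' a)
    (o a b : C) (r : ℝ)
    (hab : (Fintype.card V : ℝ) / 2 ≤ ((closer d a b).card : ℝ))
    (hr : ∀ v, d v b ≤ d v o + r) :
    ∑ v, d v a ≤ 3 * (∑ v, d v o) + Fintype.card V * r := by
  classical
  have hm : (0 : ℝ) < Fintype.card V := by exact_mod_cast Fintype.card_pos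
  have hne1 : (closer d a b).Nonempty := by
    rw [← Finset.card_pos]
    have : (0 : ℝ) < ((closer d a b).card : ℝ) := by linarith
    exact_mod_cast this
  obtain ⟨u, hu, humin⟩ := Finset.exists_min_image (closer d a b) (fun v => d v o) hne1
  rw [mem_closer] at hu
  have h1 : ∀ v, d v a ≤ d v o + (r + 2 * d u o) :=
    bound_step d htri o a r u (by have := hr u; linarith)
  have h2 : ∀ v : V, d v a ≤ d v o + (r + 2 * d u o)
      - (if v ∈ closer d a b then 2 * d u o else 0) := by
    intro v
    by_cases hv : v ∈ closer d a b
    · have h3 := (mem_closer d a b v).1 hv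
      have := hr v
      simp only [hv, if_true]
      linarith
    · simp only [hv, if_false]
      linarith [h1 v]
  have h3 := Finset.sum_le_sum (fun v (_ : v ∈ Finset.univ) => h2 v)
  rw [Finset.sum_sub_distrib, Finset.sum_add_distrib] at h3
  simp only [Finset.sum_ite_mem, Finset.univ_inter, Finset.sum_const, nsmul_eq_mul,
    Finset.card_univ] at h3
  have h4 : ((closer d a b).card : ℝ) * d u o ≤ ∑ v, d v o := by
    calc ((closer d a b).card : ℝ) * d u o = ∑ v ∈ closer d a b, d u o := by simp
      _ ≤ ∑ v ∈ closer d a b, d v o := Finset.sum_le_sum humin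
      _ ≤ ∑ v, d v o :=
        Finset.sum_le_sum_of_subset_of_nonneg (Finset.subset_univ _) (fun v _ _ => hd0 v o)
  have h5 := mul_le_mul_of_nonneg_right hab (hd0 u o)
  nlinarith

lemma majority_chain {V C : Type*} [Fintype V] [Nonempty V] (d : V → C → ℝ)
    (hd0 : ∀ v a, 0 ≤ d v a)
    (htri : ∀ v v' a b, d v a ≤ d v b + d v' b + d v' a)
    (o : C) (k : ℕ) (y : ℕ → C)
    (hmaj : ∀ i, (Fintype.card V : ℝ) / 2 ≤ ((closer d (y i) (y (i+1))).card : ℝ))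
    (hy : y k = o) :
    ∑ v, d v (y 0) ≤ (2 * (k : ℝ) + 1) * ∑ v, d v o := by
  rcases Nat.even_or_odd' k with ⟨n, hn | hn⟩
  · obtain ⟨r, hr, hb⟩ := even_chain d hd0 htri o n y hmaj (by rw [← hn]; exact hy)
    have h3 := Finset.sum_le_sum (fun v (_ : v ∈ Finset.univ) => hb v)
    rw [Finset.sum_add_distrib] at h3
    simp only [Finset.sum_const, nsmul_eq_mul, Finset.card_univ] at h3
    rw [hn]; push_cast
    linarith
  · obtain ⟨r, hr, hb⟩ := even_chain d hd0 htri o n (fun i => y (i + 1))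
      (fun i => hmaj (i + 1)) (by show y (2 * n + 1) = o; rw [← hn]; exact hy)
    have h3 := last_step d hd0 htri o (y 0) (y 1) r (hmaj 0) hb
    rw [hn]; push_cast
    linarith

lemma skip_chain {V C : Type*} [Fintype V] (d : V → C → ℝ) (p : ℝ) (y : ℕ → C)
    (h : ∀ i, p * (Fintype.card V : ℝ) ≤ ((closer d (y i) (y (i+1))).card : ℝ)) (a n : ℕ) :
    (Fintype.card V : ℝ) - n * (1 - p) * Fintype.card V
      ≤ ((closer d (y a) (y (a + n))).card : ℝ) := by
  classical
  induction n with
  | zero => simp [closer]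
  | succ n ih =>
    have hsub : closer d (y a) (y (a + n)) ∩ closer d (y (a + n)) (y (a + n + 1))
        ⊆ closer d (y a) (y (a + (n + 1))) := by
      intro v hv
      rw [Finset.mem_inter, mem_closer, mem_closer] at hv
      rw [mem_closer]
      exact hv.1.trans hv.2
    have h1 : ((closer d (y a) (y (a + n)) ∩ closer d (y (a + n)) (y (a + n + 1))).card : ℝ)
        ≤ ((closer d (y a) (y (a + (n + 1)))).card : ℝ) := by
      exact_mod_cast Finset.card_le_card hsub
    have h2 : ((closer d (y a) (y (a + n)) ∪ closer d (y (a + n)) (y (a + n + 1))).card : ℝ)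
        + ((closer d (y a) (y (a + n)) ∩ closer d (y (a + n)) (y (a + n + 1))).card : ℝ)
        = ((closer d (y a) (y (a + n))).card : ℝ)
          + ((closer d (y (a + n)) (y (a + n + 1))).card : ℝ) := by
      exact_mod_cast Finset.card_union_add_card_inter _ _
    have h3 : ((closer d (y a) (y (a + n)) ∪ closer d (y (a + n)) (y (a + n + 1))).card : ℝ)
        ≤ Fintype.card V := by exact_mod_cast Finset.card_le_univ _
    have h4 := h (a + n)
    push_cast
    linarith



/-- Chain bound with skipping.
`ℓ ≥ 2`, `p ∈ [0,1]`, `lam ≥ 1` an integer with `lam·(1 − p) ≤ 1/2`.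
Distinct candidates `x 0, …, x (ℓ-1)` such that for each consecutive pair at
least `p·m` voters prefer the earlier one.  Then
`cost (x 0) ≤ (2·⌈(ℓ−1)/lam⌉ + 1) · cost (x (ℓ-1))`. -/
theorem stmt_9
    {V C : Type*} [Fintype V] [Nonempty V] [Fintype C]
    (P : V → C → C → Prop) (hP : ∀ v, IsStrictTotalOrder C (P v))
    (ℓ : ℕ) (hℓ : 2 ≤ ℓ)
    (p : ℝ) (hp0 : 0 ≤ p) (hp1 : p ≤ 1)
    (lam : ℕ) (hlam1 : 1 ≤ lam) (hlam : (lam : ℝ) * (1 - p) ≤ 1 / 2)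
    (x : Fin ℓ → C) (hx : Function.Injective x)
    (hpref : ∀ i j : Fin ℓ, (i : ℕ) + 1 = (j : ℕ) →
      p * (Fintype.card V : ℝ) ≤ (Nat.card {v : V // P v (x i) (x j)} : ℝ))
    (d : V → C → ℝ)
    (hd0 : ∀ v a, 0 ≤ d v a)
    (htri : ∀ v v' a b, d v a ≤ d v b + d v' b + d v' a)
    (hcons : ∀ v a b, P v a b → d v a ≤ d v b) :
    (∑ v, d v (x ⟨0, by omega⟩)) ≤
      (2 * ((Int.ceil (((ℓ : ℝ) - 1) / (lam : ℝ))) : ℝ) + 1) *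
        (∑ v, d v (x ⟨ℓ - 1, by omega⟩)) := by

  classical
  have hm : (0 : ℝ) < Fintype.card V := by exact_mod_cast Fintype.card_pos
  have hl : (0 : ℝ) < lam := by exact_mod_cast hlam1
  have hℓ' : (2 : ℝ) ≤ ℓ := by exact_mod_cast hℓ
  let x' : ℕ → C := fun i => x ⟨min i (ℓ - 1), by omega⟩
  have hstep : ∀ i, p * (Fintype.card V : ℝ) ≤ ((closer d (x' i) (x' (i+1))).card : ℝ) := by
    intro i
    by_cases hi : i + 1 ≤ ℓ - 1
    · refine (hpref ⟨min i (ℓ - 1), by omega⟩ ⟨min (i + 1) (ℓ - 1), by omega⟩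
        (by simp only; omega)).trans ?_
      rw [Nat.card_eq_fintype_card, Fintype.card_subtype]
      have : (Finset.univ.filter (fun v => P v (x ⟨min i (ℓ - 1), by omega⟩)
          (x ⟨min (i + 1) (ℓ - 1), by omega⟩))) ⊆ closer d (x' i) (x' (i+1)) := by
        intro v hv
        rw [mem_closer]
        exact hcons v _ _ (Finset.mem_filter.1 hv).2
      exact_mod_cast Finset.card_le_card this
    · have heq : x' i = x' (i + 1) := by
        simp only [x']
        congr 2
        omega
      rw [heq]
      have : (closer d (x' (i+1)) (x' (i+1))).card = Fintype.card V := by simp [closer]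
      rw [this]
      nlinarith
  have hz : 0 ≤ ((ℓ : ℝ) - 1) / (lam : ℝ) := div_nonneg (by linarith) hl.le
  obtain ⟨k, hk⟩ := Int.eq_ofNat_of_zero_le (Int.ceil_nonneg hz)
  have hkl : ((ℓ : ℝ) - 1) / (lam : ℝ) ≤ k := by
    have := Int.le_ceil (((ℓ : ℝ) - 1) / (lam : ℝ))
    rw [hk] at this
    exact_mod_cast this
  rw [div_le_iff₀ hl] at hkl
  have hkl' : ℓ ≤ k * lam + 1 := by
    have : (ℓ : ℝ) ≤ k * lam + 1 := by linarith
    exact_mod_cast this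
  have hmain := majority_chain d hd0 htri (x ⟨ℓ - 1, by omega⟩) k (fun i => x' (i * lam))
    (fun i => by
      have := skip_chain d p x' hstep (i * lam) lam
      rw [show (i + 1) * lam = i * lam + lam by ring]
      refine le_trans ?_ this
      nlinarith)
    (by
      simp only [x']
      congr 2
      omega)
  have h0 : x' (0 * lam) = x ⟨0, by omega⟩ := by
    simp only [x']
    congr 2
    omega
  simp only [h0] at hmain
  rw [hk]
  exact_mod_cast hmain
end

section
/- Suppose C contains n ≥ 2 candidates. Let w ≠ c be candidates, and suppose there exist p ∈ [0,1] and a sequence of distinct candidates w = x_1, x_2, …, x_ℓ = c such that for each i = 1, …, ℓ−1 at least p·m voters v have x_i ≻_v x_{i+1}, and at most p·m voters v have c ≻_v w. Then for every pseudometric d consistent with the profile, cost(w) ≤ max( 2·√(2n) − 1 , 2·⌈(n−1)/⌊√(n/2)⌋⌉ + 1 ) · cost(c). -/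
open Finset Classical in
theorem aux_core {V : Type*} [Fintype V] (e : V → ℝ) (F : ℕ → V → ℝ) (δ : ℕ → ℝ)
    (he : ∀ v, 0 ≤ e v)
    (h1 : ∀ i v, F i v ≤ e v + δ i) (h2 : ∀ i v, δ i ≤ F i v + e v)
    (hS : ∀ i, (Fintype.card V : ℝ) ≤ 2 * ((univ.filter (fun v => F i v ≤ F (i+1) v)).card : ℝ))
    (L : ℕ) (hL : δ L = 0) :
    ∑ v, F 0 v ≤ (2 * (L : ℝ) + 1) * ∑ v, e v := by
  set m : ℝ := (Fintype.card V : ℝ) with hm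
  set E := ∑ v, e v with hE
  have hE0 : 0 ≤ E := Finset.sum_nonneg (fun v _ => he v)
  have hm0 : 0 ≤ m := by positivity
  let S : ℕ → Finset V := fun i => univ.filter (fun v => F i v ≤ F (i+1) v)
  have hS' : ∀ i, m ≤ 2 * ((S i).card : ℝ) := hS
  have sumS : ∀ i (a : ℝ), ∑ v, (if v ∈ S i then a else 0) = ((S i).card : ℝ) * a := by
    intro i a
    rw [← Finset.sum_filter]
    simp
  have single : ∀ i, m * (δ i - δ (i+1)) ≤ 4 * E := by
    intro i
    by_cases hg : 0 ≤ δ i - δ (i+1)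
    · have : ∑ v, (if v ∈ S i then (δ i - δ (i+1)) else 0) ≤ ∑ v, 2 * e v := by
        apply Finset.sum_le_sum
        intro v _
        split_ifs with hv
        · have := (Finset.mem_filter.1 hv).2
          linarith [h1 (i+1) v, h2 i v]
        · linarith [he v]
      rw [sumS, ← Finset.mul_sum] at this
      nlinarith [mul_le_mul_of_nonneg_right (hS' i) hg]
    · push Not at hg
      nlinarith [mul_nonneg hm0 (neg_nonneg.2 hg.le)]
  have pair : ∀ i, m * (δ i - δ (i+2)) ≤ 4 * E := by
    intro i
    by_cases hg : 0 ≤ δ i - δ (i+1)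
    · by_cases hg' : 0 ≤ δ (i+1) - δ (i+2)
      · have : ∑ v, ((if v ∈ S i then (δ i - δ (i+1)) else 0)
            + (if v ∈ S (i+1) then (δ (i+1) - δ (i+2)) else 0)) ≤ ∑ v, 2 * e v := by
          apply Finset.sum_le_sum
          intro v _
          have a1 := h1 (i+1) v
          have a2 := h1 (i+2) v
          have b0 := h2 i v
          have b1 := h2 (i+1) v
          split_ifs with hv hv' hv'
          · have q := (Finset.mem_filter.1 hv).2
            have q' : F (i+1) v ≤ F (i+2) v := (Finset.mem_filter.1 hv').2
            linarith
          · have q := (Finset.mem_filter.1 hv).2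
            linarith
          · have q' : F (i+1) v ≤ F (i+2) v := (Finset.mem_filter.1 hv').2
            linarith
          · linarith [he v]
        rw [Finset.sum_add_distrib, sumS, sumS, ← Finset.mul_sum] at this
        nlinarith [mul_le_mul_of_nonneg_right (hS' i) hg,
          mul_le_mul_of_nonneg_right (hS' (i+1)) hg']
      · push Not at hg'
        nlinarith [mul_nonneg hm0 (neg_nonneg.2 hg'.le), single i]
    · push Not at hg
      have := single (i+1)
      rw [show i + 1 + 1 = i + 2 from rfl] at this
      nlinarith [mul_nonneg hm0 (neg_nonneg.2 hg.le)]
  have chain : ∀ j i, m * (δ i - δ (i + 2 * j)) ≤ 4 * (j : ℝ) * E := by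
    intro j
    induction j with
    | zero => intro i; simp
    | succ j ih =>
      intro i
      have := ih i
      have h := pair (i + 2 * j)
      rw [show i + 2 * (j+1) = i + 2 * j + 2 by ring]
      push_cast
      nlinarith
  have total : ∀ a : ℝ, ∑ v, (e v + a) = E + m * a := by
    intro a
    rw [Finset.sum_add_distrib]
    simp [hm, hE]
  rcases Nat.even_or_odd' L with ⟨j, hj | hj⟩
  · have c := chain j 0
    rw [zero_add, ← hj, hL] at c
    have : ∑ v, F 0 v ≤ ∑ v, (e v + δ 0) := Finset.sum_le_sum (fun v _ => h1 0 v)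
    rw [total] at this
    have : (L : ℝ) = 2 * j := by rw [hj]; push_cast; ring
    rw [this]
    nlinarith
  · have c := chain j 1
    rw [show 1 + 2 * j = L by omega, hL] at c
    have hLr : (L : ℝ) = 2 * j + 1 := by rw [hj]; push_cast; ring
    rw [hLr]
    by_cases hg : 0 ≤ δ 0 - δ 1
    · have h := single 0
      rw [zero_add] at h
      have : ∑ v, (F 0 v + (if v ∈ S 0 then (δ 0 - δ 1) else 0)) ≤ ∑ v, (e v + δ 0) := by
        apply Finset.sum_le_sum
        intro v _
        split_ifs with hv
        · have := (Finset.mem_filter.1 hv).2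
          rw [zero_add] at this
          linarith [h1 1 v]
        · linarith [h1 0 v]
      rw [total, Finset.sum_add_distrib, sumS] at this
      nlinarith [mul_le_mul_of_nonneg_right (hS' 0) hg]
    · push Not at hg
      have : ∑ v, F 0 v ≤ ∑ v, (e v + δ 1) :=
        Finset.sum_le_sum (fun v _ => by linarith [h1 0 v])
      rw [total] at this
      nlinarith

open Finset Classical in
theorem aux_direct {V : Type*} [Fintype V] (e f : V → ℝ) (δ : ℝ) (s : ℝ)
    (he : ∀ v, 0 ≤ e v) (hδ : 0 ≤ δ) (hs : 1 ≤ s)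
    (h1 : ∀ v, f v ≤ e v + δ) (h2 : ∀ v, δ ≤ f v + e v)
    (hS : (Fintype.card V : ℝ) ≤ s * ((univ.filter (fun v => f v ≤ e v)).card : ℝ)) :
    ∑ v, f v ≤ (2 * s - 1) * ∑ v, e v := by
  set m : ℝ := (Fintype.card V : ℝ) with hm
  set E := ∑ v, e v with hE
  set S := univ.filter (fun v => f v ≤ e v) with hSd
  have sumS : ∀ (a : ℝ), ∑ v, (if v ∈ S then a else 0) = (S.card : ℝ) * a := by
    intro a
    rw [← Finset.sum_filter]
    simp
  have total : ∀ a : ℝ, ∑ v, (e v + a) = E + m * a := by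
    intro a
    rw [Finset.sum_add_distrib]
    simp [hm, hE]
  have a : ∑ v, (f v + (if v ∈ S then δ else 0)) ≤ ∑ v, (e v + δ) := by
    apply Finset.sum_le_sum
    intro v _
    split_ifs with hv
    · have := (Finset.mem_filter.1 hv).2
      linarith
    · linarith [h1 v]
  have b : ∑ v, (if v ∈ S then δ else 0) ≤ ∑ v, 2 * e v := by
    apply Finset.sum_le_sum
    intro v _
    split_ifs with hv
    · have := (Finset.mem_filter.1 hv).2
      linarith [h2 v]
    · linarith [he v]
  rw [total, Finset.sum_add_distrib, sumS] at a
  rw [sumS, ← Finset.mul_sum] at b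
  have c1 := mul_le_mul_of_nonneg_right hS hδ
  have c2 := mul_le_mul_of_nonneg_left b (sub_nonneg.2 hs)
  nlinarith

open Finset Classical in
/-- union bound over a block -/
theorem aux_block {V : Type*} [Fintype V] (G : ℕ → V → ℝ) (b : ℝ)
    (h : ∀ j, (Fintype.card V : ℝ) - b ≤ ((univ.filter (fun v => G j v ≤ G (j+1) v)).card : ℝ))
    (i k : ℕ) :
    (Fintype.card V : ℝ) - k * b ≤ ((univ.filter (fun v => G i v ≤ G (i+k) v)).card : ℝ) := by
  induction k with
  | zero => simp
  | succ k ih =>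
    have hj := h (i+k)
    set A := univ.filter (fun v => G i v ≤ G (i+k) v)
    set B := univ.filter (fun v => G (i+k) v ≤ G (i+k+1) v)
    have sub : A ∩ B ⊆ univ.filter (fun v => G i v ≤ G (i+(k+1)) v) := by
      intro v hv
      simp only [A, B, Finset.mem_inter, Finset.mem_filter, Finset.mem_univ, true_and] at hv ⊢
      exact hv.1.trans hv.2
    have c1 := Finset.card_le_card sub
    have c2 := Finset.card_union_add_card_inter A B
    have c3 : (A ∪ B).card ≤ Fintype.card V := Finset.card_le_univ _
    have c4 : A.card + B.card ≤ Fintype.card V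
        + (univ.filter (fun v => G i v ≤ G (i+(k+1)) v)).card := by omega
    have c5 : (A.card : ℝ) + B.card ≤ Fintype.card V
        + ((univ.filter (fun v => G i v ≤ G (i+(k+1)) v)).card : ℝ) := by exact_mod_cast c4
    push_cast
    linarith

/-- Upper bound on the distortion of any rule satisfying the
Ranked-Pairs/Schulze path property.  `n = |C| ≥ 2`; `w ≠ c`; there exist
`p ∈ [0,1]` and a sequence of distinct candidates `w = x_1, …, x_ℓ = c` with
each step preferred by at least `p·m` voters, while at most `p·m` voters
prefer `c` to `w`.  Then for every consistent pseudometric,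
`cost w ≤ max(2√(2n) − 1, 2·⌈(n−1)/⌊√(n/2)⌋⌉ + 1) · cost c`. -/
theorem stmt_10
    {V C : Type*} [Fintype V] [Nonempty V] [Fintype C]
    (P : V → C → C → Prop) (hP : ∀ v, IsStrictTotalOrder C (P v))
    (n : ℕ) (hn : n = Fintype.card C) (hn2 : 2 ≤ n)
    (w c : C) (hwc : w ≠ c)
    (hseq : ∃ (p : ℝ) (ℓ : ℕ) (hℓ : 2 ≤ ℓ) (x : Fin ℓ → C),
      0 ≤ p ∧ p ≤ 1 ∧ Function.Injective x ∧
      x ⟨0, by omega⟩ = w ∧ x ⟨ℓ - 1, by omega⟩ = c ∧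
      (∀ i j : Fin ℓ, (i : ℕ) + 1 = (j : ℕ) →
        p * (Fintype.card V : ℝ) ≤ (Nat.card {v : V // P v (x i) (x j)} : ℝ)) ∧
      (Nat.card {v : V // P v c w} : ℝ) ≤ p * (Fintype.card V : ℝ))
    (d : V → C → ℝ)
    (hd0 : ∀ v a, 0 ≤ d v a)
    (htri : ∀ v v' a b, d v a ≤ d v b + d v' b + d v' a)
    (hcons : ∀ v a b, P v a b → d v a ≤ d v b) :
    (∑ v, d v w) ≤
      max (2 * Real.sqrt (2 * (n : ℝ)) - 1)
        (2 * ((Int.ceil (((n : ℝ) - 1) /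
          ((Int.floor (Real.sqrt ((n : ℝ) / 2))) : ℝ))) : ℝ) + 1) *
      (∑ v, d v c) := by
  classical
  obtain ⟨p, ℓ, hℓ, x, hp0, hp1, hinj, hx0, hxl, hstep, hback⟩ := hseq
  have hm0 : (0 : ℝ) < (Fintype.card V : ℝ) := by exact_mod_cast Fintype.card_pos
  -- candidate distances to `c`
  have hD : ∀ a : C, ∃ t : ℝ, 0 ≤ t ∧ (∀ v, d v a ≤ d v c + t) ∧ (∀ v, t ≤ d v a + d v c)
      ∧ (a = c → t = 0) := by
    intro a
    by_cases hac : a = c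
    · subst hac
      exact ⟨0, le_refl _, fun v => by simp, fun v => by linarith [hd0 v a], fun _ => rfl⟩
    · obtain ⟨u, hu⟩ := Finite.exists_min (fun v => d v a + d v c)
      refine ⟨d u a + d u c, by linarith [hd0 u a, hd0 u c], fun v => ?_, hu, fun h => absurd h hac⟩
      linarith [htri v u a c]
  choose D hDnn hD1 hD2 hDc using hD
  have hcount : ∀ a b : C, (Nat.card {v : V // P v a b} : ℝ)
      ≤ ((Finset.univ.filter (fun v => d v a ≤ d v b)).card : ℝ) := by
    intro a b
    rw [Nat.card_eq_fintype_card, Fintype.card_subtype]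
    exact_mod_cast Finset.card_le_card (fun v hv => by
      simp only [Finset.mem_filter, Finset.mem_univ, true_and] at hv ⊢
      exact hcons v a b hv)
  have hE0 : 0 ≤ ∑ v, d v c := Finset.sum_nonneg (fun v _ => hd0 v c)
  have hn2r : (2 : ℝ) ≤ n := by exact_mod_cast hn2
  set s := Real.sqrt (2 * (n : ℝ)) with hs
  have hs1 : 1 ≤ s := by
    rw [hs, Real.one_le_sqrt]; linarith
  have hss : s * s = 2 * n := Real.mul_self_sqrt (by linarith)
  set r := Real.sqrt ((n : ℝ) / 2) with hr
  have hr1 : 1 ≤ r := by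
    rw [hr, Real.one_le_sqrt]; linarith
  have hsr : s = 2 * r := by
    rw [hs, hr, show 2 * (n : ℝ) = 2 ^ 2 * ((n : ℝ) / 2) by ring, Real.sqrt_mul (by norm_num),
      Real.sqrt_sq (by norm_num)]
  by_cases hcase : 1 ≤ s * (1 - p)
  · refine le_trans ?_ (mul_le_mul_of_nonneg_right (le_max_left _ _) hE0)
    apply aux_direct (fun v => d v c) (fun v => d v w) (D w) s (fun v => hd0 v c) (hDnn w) hs1
      (hD1 w) (hD2 w)
    have h1 := hcount w c
    have h2 : (Fintype.card V) ≤ Nat.card {v : V // P v w c} + Nat.card {v : V // P v c w} := by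
      rw [Nat.card_eq_fintype_card, Nat.card_eq_fintype_card, Fintype.card_subtype,
        Fintype.card_subtype, ← Finset.card_univ]
      refine le_trans (Finset.card_le_card ?_) (Finset.card_union_le _ _)
      intro v _
      simp only [Finset.mem_union, Finset.mem_filter, Finset.mem_univ, true_and]
      have := hP v
      rcases trichotomous_of (P v) w c with h | h | h
      · exact Or.inl h
      · exact absurd h hwc
      · exact Or.inr h
    have h2r : (Fintype.card V : ℝ) ≤ Nat.card {v : V // P v w c} + Nat.card {v : V // P v c w} := by
      exact_mod_cast h2
    have h3 : (1 - p) * (Fintype.card V : ℝ)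
        ≤ ((Finset.univ.filter (fun v => d v w ≤ d v c)).card : ℝ) := by linarith
    have h4 := mul_le_mul_of_nonneg_left h3 (by linarith : 0 ≤ s)
    nlinarith
  · push Not at hcase
    refine le_trans ?_ (mul_le_mul_of_nonneg_right (le_max_right _ _) hE0)
    have hk1 : 1 ≤ ⌊r⌋ := Int.le_floor.2 (by exact_mod_cast hr1)
    obtain ⟨k, hk⟩ := Int.eq_ofNat_of_zero_le (by omega : 0 ≤ ⌊r⌋)
    have hkr : (k : ℝ) ≤ r := by
      have := Int.floor_le r
      rw [hk] at this
      exact_mod_cast this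
    have hkpos : 1 ≤ k := by omega
    have hkposr : (0 : ℝ) < k := by exact_mod_cast hkpos
    rw [hk]
    have hq0 : (0 : ℝ) ≤ ((n : ℝ) - 1) / (((k : ℤ) : ℝ)) :=
      div_nonneg (by linarith) (by exact_mod_cast hkposr.le)
    obtain ⟨L, hL⟩ := Int.eq_ofNat_of_zero_le (Int.ceil_nonneg hq0)
    have hLk : n ≤ L * k + 1 := by
      have h := Int.le_ceil (((n : ℝ) - 1) / (((k : ℤ) : ℝ)))
      rw [hL, Int.cast_natCast, Int.cast_natCast, div_le_iff₀ hkposr] at h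
      have : (n : ℝ) ≤ (L : ℝ) * k + 1 := by linarith
      exact_mod_cast this
    rw [hL, Int.cast_natCast]
    have hln : ℓ ≤ n := by
      rw [hn]
      simpa using Fintype.card_le_of_injective x hinj
    let X : ℕ → C := fun j => x ⟨min j (ℓ - 1), by omega⟩
    have hX0 : X 0 = w := by
      rw [← hx0]
      simp [X]
    have hXL : ∀ j, ℓ - 1 ≤ j → X j = c := by
      intro j hj
      rw [← hxl]
      simp [X, hj]
    have hG : ∀ j, (Fintype.card V : ℝ) - (1 - p) * (Fintype.card V : ℝ)
        ≤ ((Finset.univ.filter (fun v => d v (X j) ≤ d v (X (j+1)))).card : ℝ) := by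
      intro j
      by_cases hj : j + 1 ≤ ℓ - 1
      · refine le_trans ?_ (hcount _ _)
        have := hstep ⟨min j (ℓ - 1), by omega⟩ ⟨min (j+1) (ℓ - 1), by omega⟩
          (by simp only []; omega)
        simp only [X]
        linarith
      · rw [hXL j (by omega), hXL (j+1) (by omega)]
        simp
        nlinarith
    have := aux_core (fun v => d v c) (fun i v => d v (X (i * k))) (fun i => D (X (i * k)))
      (fun v => hd0 v c) (fun i v => hD1 _ v) (fun i v => hD2 _ v) (by
        intro i
        have h := aux_block (fun j v => d v (X j)) _ hG (i * k) k
        rw [show i * k + k = (i + 1) * k by ring] at h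
        have h5 : (k : ℝ) * (1 - p) ≤ 1 / 2 := by
          have := mul_le_mul_of_nonneg_right hkr (sub_nonneg.2 hp1)
          rw [hsr] at hcase
          linarith
        have h6 := mul_le_mul_of_nonneg_right h5 hm0.le
        have h7 := h
        linarith) L (hDc _ (hXL _ (by omega)))
    simpa [hX0] using this
end

section
/- For every even integer m ≥ 2, with B = m/2 and n = m·B, there exist an instance with m + 2 voters and n candidates x_1, …, x_n and a pseudometric d consistent with its profile such that: (a) for every i = 1, …, n−1, at least m + 1 of the voters v have x_i ≻_v x_{i+1}; (b) at most m voters v have x_n ≻_v x_1; and (c) cost(x_n) > 0 and cost(x_1) ≥ (m/2) · cost(x_n). -/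
/-- Number of distance drops of voter `v` that happened up to candidate `i`. -/
def dropCount (m v i : ℕ) : ℕ := (i + m - v) / m

/-- The (integer) distance between voter `v` and candidate `i`. -/
def distNat (m B v i : ℕ) : ℕ := if v < m then 1 + 2 * (B - dropCount m v i) else B

lemma dropCount_lower (m v i : ℕ) (hv : v < m) : i / m ≤ dropCount m v i := by
  unfold dropCount
  exact Nat.div_le_div_right (by omega)

lemma dropCount_upper (m v i : ℕ) (hv : v < m) : dropCount m v i ≤ i / m + 1 := by
  unfold dropCount
  rw [← Nat.add_div_right i (by omega : 0 < m)]
  exact Nat.div_le_div_right (by omega)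

lemma dropCount_le (m B v i : ℕ) (hv : v < m) (hi : i < m * B) : dropCount m v i ≤ B := by
  unfold dropCount
  rw [← Nat.lt_succ_iff, Nat.div_lt_iff_lt_mul (by omega)]
  have : (B + 1) * m = m * B + m := by ring
  simp only [Nat.succ_eq_add_one]
  omega

lemma dropCount_last (m B v : ℕ) (hv : v < m) (hB : 0 < B) :
    dropCount m v (m * B - 1) = B := by
  apply le_antisymm
  · exact dropCount_le m B v _ hv (Nat.sub_lt (Nat.mul_pos (by omega) hB) one_pos)
  · unfold dropCount
    rw [Nat.le_div_iff_mul_le (by omega)]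
    have : B * m = m * B := by ring
    have : 0 < m * B := Nat.mul_pos (by omega) hB
    omega

lemma dropCount_step (m v i : ℕ) (hv : v < m) (h : dropCount m v (i + 1) ≠ dropCount m v i) :
    v = (i + 1) % m := by
  unfold dropCount at h
  have e : i + 1 + m - v = (i + m - v) + 1 := by omega
  rw [e, Nat.succ_div] at h
  split_ifs at h with hd
  · obtain ⟨k, hk⟩ := hd
    have h1 : i + 1 + m = v + m * k := by omega
    have h2 : (i + 1 + m) % m = (v + m * k) % m := by rw [h1]
    rw [Nat.add_mod_right, Nat.add_mul_mod_self_left, Nat.mod_eq_of_lt hv] at h2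
    exact h2.symm
  · exact absurd rfl h

lemma dropCount_mono (m v i : ℕ) : dropCount m v i ≤ dropCount m v (i + 1) := by
  unfold dropCount
  exact Nat.div_le_div_right (by omega)

lemma distNat_tri (m B v v' x y : ℕ) (hx : x < m * B) (hy : y < m * B) :
    distNat m B v x ≤ distNat m B v y + distNat m B v' y + distNat m B v' x := by
  unfold distNat
  split_ifs with h1 h2
  · have a1 := dropCount_lower m v x h1
    have a2 := dropCount_upper m v' x h2
    have a3 := dropCount_le m B v y h1 hy
    have a4 := dropCount_le m B v' x h2 hx
    omega
  · omega
  · omega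
  · omega

lemma sum_dist_last (m B : ℕ) (hB : 0 < B) :
    ∑ v : Fin (m + 2), distNat m B v (m * B - 1) = m + 2 * B := by
  rw [Fin.sum_univ_add]
  have h1 : ∀ i : Fin m, distNat m B (Fin.castAdd 2 i : Fin (m + 2)) (m * B - 1) = 1 := by
    intro i
    simp [distNat, dropCount_last m B i i.2 hB]
  have h2 : ∀ i : Fin 2, distNat m B (Fin.natAdd m i : Fin (m + 2)) (m * B - 1) = B := by
    intro i
    simp [distNat]
  simp only [h1, h2]
  simp

lemma sum_dist_first (m B : ℕ) (hB : 0 < B) :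
    m * (2 * B - 1) + 2 * B ≤ ∑ v : Fin (m + 2), distNat m B v 0 := by
  rw [Fin.sum_univ_add]
  have h1 : ∀ i : Fin m, 2 * B - 1 ≤ distNat m B (Fin.castAdd 2 i : Fin (m + 2)) 0 := by
    intro i
    have := dropCount_upper m i 0 i.2
    simp at this
    simp [distNat]
    omega
  have h2 : ∀ i : Fin 2, distNat m B (Fin.natAdd m i : Fin (m + 2)) 0 = B := by
    intro i
    simp [distNat]
  have h3 := Finset.sum_le_sum (s := Finset.univ) (fun i _ => h1 i)
  simp only [h2]
  simp at h3 ⊢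
  exact h3

/-- Preference: closer first, ties broken by index. -/
def pref (m B : ℕ) (v : Fin (m + 2)) (x y : Fin (m * B)) : Prop :=
  distNat m B v x < distNat m B v y ∨ (distNat m B v x = distNat m B v y ∧ x < y)

lemma pref_sto (m B : ℕ) (v : Fin (m + 2)) : IsStrictTotalOrder (Fin (m * B)) (pref m B v) where
  trichotomous a b h1 h2 := by
    simp only [pref, Fin.lt_def] at h1 h2
    apply Fin.ext
    omega
  irrefl a h := by
    simp only [pref, Fin.lt_def] at h
    omega
  trans a b c h1 h2 := by
    simp only [pref, Fin.lt_def] at h1 h2 ⊢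
    omega

lemma card_step (m B : ℕ) (i j : Fin (m * B)) (hij : (i : ℕ) + 1 = j) :
    m + 1 ≤ Nat.card {v : Fin (m + 2) // pref m B v i j} := by
  classical
  rw [Nat.card_eq_fintype_card, Fintype.card_subtype]
  have h := Finset.card_filter_add_card_filter_not (s := (Finset.univ : Finset (Fin (m + 2))))
    (fun v => pref m B v i j)
  have h1 : (Finset.univ.filter (fun v : Fin (m + 2) => ¬ pref m B v i j)).card ≤ 1 := by
    have key : ∀ v : Fin (m + 2), ¬ pref m B v i j → (v : ℕ) = (i + 1) % m := by
      intro v hv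
      simp only [pref, Fin.lt_def, distNat] at hv
      rw [← hij] at hv
      split_ifs at hv with hvm
      · apply dropCount_step m v i hvm
        intro he
        rw [he] at hv
        omega
      · omega
    rw [Finset.card_le_one]
    intro a ha b hb
    simp only [Finset.mem_filter, Finset.mem_univ, true_and] at ha hb
    exact Fin.ext ((key a ha).trans (key b hb).symm)
  simp only [Finset.card_univ, Fintype.card_fin] at h
  omega

lemma card_back (m B : ℕ) (c0 cN : Fin (m * B)) (h0 : (c0 : ℕ) = 0) :
    Nat.card {v : Fin (m + 2) // pref m B v cN c0} ≤ m := by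
  have key : ∀ v : Fin (m + 2), pref m B v cN c0 → (v : ℕ) < m := by
    intro v hv
    by_contra hvm
    simp only [pref, Fin.lt_def, distNat, if_neg hvm] at hv
    omega
  have := Nat.card_le_card_of_injective
    (fun v : {v : Fin (m + 2) // pref m B v cN c0} => (⟨v.1, key v.1 v.2⟩ : Fin m))
    (fun a b hab => Subtype.ext (Fin.ext (by simpa using hab)))
  simpa using this

/-- The lower-bound construction for Ranked Pairs / Schulze.
For every even `m ≥ 2`, with `B = m/2` and `n = m·B`, there is an instance with
`m + 2` voters and `n` candidates (indexed by `Fin n`, with `c0` the first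
candidate `x_1` and `cN` the last candidate `x_n`) and a consistent
pseudometric `d` such that:
(a) each consecutive pair `x_i ≻ x_{i+1}` is preferred by at least `m + 1`
voters; (b) at most `m` voters prefer `x_n` to `x_1`; and
(c) `cost x_n > 0` and `cost x_1 ≥ (m/2) · cost x_n`. -/
theorem stmt_11 (m : ℕ) (hm : 2 ≤ m) (hme : Even m) :
    ∃ (P : Fin (m + 2) → Fin (m * (m / 2)) → Fin (m * (m / 2)) → Prop),
      (∀ v, IsStrictTotalOrder (Fin (m * (m / 2))) (P v)) ∧
      ∃ (d : Fin (m + 2) → Fin (m * (m / 2)) → ℝ)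
        (c0 cN : Fin (m * (m / 2))),
        (c0 : ℕ) = 0 ∧ (cN : ℕ) = m * (m / 2) - 1 ∧
        (∀ v x, 0 ≤ d v x) ∧
        (∀ v v' x y, d v x ≤ d v y + d v' y + d v' x) ∧
        (∀ v x y, P v x y → d v x ≤ d v y) ∧
        (∀ i j : Fin (m * (m / 2)), (i : ℕ) + 1 = (j : ℕ) →
          m + 1 ≤ Nat.card {v : Fin (m + 2) // P v i j}) ∧
        Nat.card {v : Fin (m + 2) // P v cN c0} ≤ m ∧
        0 < (∑ v, d v cN) ∧
        ((m : ℝ) / 2) * (∑ v, d v cN) ≤ (∑ v, d v c0) := by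
  obtain ⟨B, hB⟩ := hme
  have hB2 : m / 2 = B := by omega
  have hmR : (m : ℝ) / 2 = B := by rw [hB]; push_cast; ring
  have hmR' : (m : ℝ) = 2 * B := by linarith
  rw [hB2, hmR]
  have hBpos : 0 < B := by omega
  have hn : 0 < m * B := Nat.mul_pos (by omega) hBpos
  refine ⟨pref m B, pref_sto m B, fun v x => (distNat m B v x : ℝ), ⟨0, hn⟩,
    ⟨m * B - 1, by omega⟩, rfl, rfl, fun v x => Nat.cast_nonneg _, ?_, ?_,
    card_step m B, card_back m B _ _ rfl, ?_, ?_⟩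
  · intro v v' x y
    beta_reduce
    exact_mod_cast distNat_tri m B v v' x y x.2 y.2
  · intro v x y h
    simp only [pref] at h
    have : distNat m B v x ≤ distNat m B v y := by omega
    beta_reduce
    exact_mod_cast this
  · rw [← Nat.cast_sum, sum_dist_last m B hBpos]
    exact_mod_cast (by omega : 0 < m + 2 * B)
  · rw [← Nat.cast_sum, ← Nat.cast_sum, sum_dist_last m B hBpos]
    have h := sum_dist_first m B hBpos
    refine le_trans ?_ (Nat.cast_le.mpr h)
    have e : ((2 * B - 1 : ℕ) : ℝ) = 2 * B - 1 := by
      rw [Nat.cast_sub (by omega)]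
      push_cast
      ring
    rw [Nat.cast_add (m * (2 * B - 1)), Nat.cast_mul m (2 * B - 1), e]
    push_cast
    rw [hmR']
    apply le_of_eq
    ring
end

section
/- Let x ≠ y be two candidates. If the bipartite graph B(x,y) has a perfect matching, then for every pseudometric d consistent with the profile, cost(x) ≤ 3 · cost(y). -/
/-- If the bipartite graph `B(x,y)` (edge `(v,v')` iff some
candidate `z` satisfies `x ⪰_v z` and `z ⪰_{v'} y`) has a perfect matching
(a bijection `M : V → V` all of whose pairs are edges), then
`cost x ≤ 3 · cost y` for every consistent pseudometric. -/
theorem stmt_12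
    {V C : Type*} [Fintype V] [Nonempty V] [Fintype C]
    (P : V → C → C → Prop) (hP : ∀ v, IsStrictTotalOrder C (P v))
    (x y : C) (hxy : x ≠ y)
    (M : V → V) (hM : Function.Bijective M)
    (hmatch : ∀ v : V, ∃ z : C,
      (P v x z ∨ x = z) ∧ (P (M v) z y ∨ z = y))
    (d : V → C → ℝ)
    (hd0 : ∀ v a, 0 ≤ d v a)
    (htri : ∀ v v' a b, d v a ≤ d v b + d v' b + d v' a)
    (hcons : ∀ v a b, P v a b → d v a ≤ d v b) :
    (∑ v, d v x) ≤ 3 * (∑ v, d v y) := by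
  have key : ∀ v, d v x ≤ d v y + 2 * d (M v) y := by
    intro v
    obtain ⟨z, h1, h2⟩ := hmatch v
    have a1 : d v x ≤ d v z := by
      rcases h1 with h | h
      · exact hcons _ _ _ h
      · rw [h]
    have a2 : d (M v) z ≤ d (M v) y := by
      rcases h2 with h | h
      · exact hcons _ _ _ h
      · rw [h]
    have a3 := htri v (M v) z y
    linarith
  have hs : ∑ v, d (M v) y = ∑ v, d v y := hM.sum_comp (fun v => d v y)
  calc ∑ v, d v x ≤ ∑ v, (d v y + 2 * d (M v) y) := Finset.sum_le_sum fun v _ => key v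
    _ = 3 * ∑ v, d v y := by
      rw [Finset.sum_add_distrib, ← Finset.mul_sum, hs]
      ring
end

section
/- Let x ≠ y be two candidates. The bipartite graph B(x,y) has no perfect matching if and only if there exists a set E ⊆ C of candidates with x ∈ E and y ∉ E such that |{v ∈ V : y ≻_v z for all z ∈ E}| + |{v ∈ V : z ≻_v x for all z ∈ C \ E}| > m. -/
/-- Hall-type characterization.  For `x ≠ y`, the bipartite graph
`B(x,y)` has no perfect matching iff there is a set `E ⊆ C` of candidates with
`x ∈ E`, `y ∉ E` such that the number of voters ranking `y` strictly ahead of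
all of `E`, plus the number of voters ranking `x` strictly behind all of
`C \ E`, exceeds `m`. -/
theorem stmt_14
    {V C : Type*} [Fintype V] [Nonempty V] [Fintype C]
    (P : V → C → C → Prop) (hP : ∀ v, IsStrictTotalOrder C (P v))
    (x y : C) (hxy : x ≠ y) :
    (¬ ∃ M : V → V, Function.Bijective M ∧
        ∀ v : V, ∃ z : C, (P v x z ∨ x = z) ∧ (P (M v) z y ∨ z = y)) ↔
    ∃ E : Set C, x ∈ E ∧ y ∉ E ∧
      Fintype.card V <
        Nat.card {v : V // ∀ z ∈ E, P v y z} +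
        Nat.card {v : V // ∀ z ∈ Eᶜ, P v z x} := by
  classical
  have irr : ∀ v a, ¬ P v a a := fun v a => (hP v).toIsStrictOrder.toIrrefl.irrefl a
  have tr : ∀ v a b c, P v a b → P v b c → P v a c :=
    fun v a b c => (hP v).toIsStrictOrder.toIsTrans.trans a b c
  have tri : ∀ v a b, P v a b ∨ a = b ∨ P v b a := fun v a b => by
    by_cases h1 : P v a b
    · exact Or.inl h1
    · by_cases h2 : P v b a
      · exact Or.inr (Or.inr h2)
      · exact Or.inr (Or.inl ((hP v).toTrichotomous.trichotomous a b h1 h2))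
  constructor
  · intro hM
    have hall : ¬ ∀ A : Finset V, A.card ≤
        (Finset.univ.filter fun b : V => ∃ a ∈ A,
          ∃ z : C, (P a x z ∨ x = z) ∧ (P b z y ∨ z = y)).card := by
      intro h
      obtain ⟨f, hf, hr⟩ := (Fintype.all_card_le_filter_rel_iff_exists_injective
        (fun a b : V => ∃ z : C, (P a x z ∨ x = z) ∧ (P b z y ∨ z = y))).1 h
      exact hM ⟨f, Finite.injective_iff_bijective.1 hf, hr⟩
    push Not at hall
    obtain ⟨S, hS⟩ := hall
    set N := Finset.univ.filter fun b : V => ∃ a ∈ S,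
          ∃ z : C, (P a x z ∨ x = z) ∧ (P b z y ∨ z = y) with hN
    refine ⟨{z | ∃ a ∈ S, P a x z ∨ x = z}, ?_, ?_, ?_⟩
    · obtain ⟨a, ha⟩ : S.Nonempty := Finset.card_pos.1 (by omega)
      exact ⟨a, ha, Or.inr rfl⟩
    · rintro ⟨a, ha, h⟩
      have : N = Finset.univ := by
        ext b
        simp only [hN, Finset.mem_filter, Finset.mem_univ, true_and, iff_true]
        exact ⟨a, ha, y, h, Or.inr rfl⟩
      have h2 := Finset.card_le_univ S
      rw [this, Finset.card_univ] at hS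
      omega
    · rw [Nat.card_eq_fintype_card, Nat.card_eq_fintype_card, Fintype.card_subtype,
        Fintype.card_subtype]
      have h1 : Nᶜ.card ≤ (Finset.univ.filter fun v : V =>
          ∀ z ∈ {z | ∃ a ∈ S, P a x z ∨ x = z}, P v y z).card := by
        apply Finset.card_le_card
        intro b hb
        simp only [Finset.mem_filter, Finset.mem_univ, true_and]
        rintro z ⟨a, ha, h⟩
        rcases tri b y z with h3 | h3 | h3
        · exact h3
        · exact absurd (Finset.mem_filter.2
            ⟨Finset.mem_univ b, a, ha, z, h, Or.inr h3.symm⟩) (Finset.mem_compl.1 hb)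
        · exact absurd (Finset.mem_filter.2
            ⟨Finset.mem_univ b, a, ha, z, h, Or.inl h3⟩) (Finset.mem_compl.1 hb)
      have h2 : S.card ≤ (Finset.univ.filter fun v : V =>
          ∀ z ∈ {z | ∃ a ∈ S, P a x z ∨ x = z}ᶜ, P v z x).card := by
        apply Finset.card_le_card
        intro a ha
        simp only [Finset.mem_filter, Finset.mem_univ, true_and]
        intro z hz
        rcases tri a z x with h3 | h3 | h3
        · exact h3
        · exact absurd ⟨a, ha, Or.inr h3.symm⟩ hz
        · exact absurd ⟨a, ha, Or.inl h3⟩ hz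
      have h3 := Finset.card_add_card_compl N
      omega
  · rintro ⟨E, -, -, hlt⟩ ⟨M, hM, hr⟩
    rw [Nat.card_eq_fintype_card, Nat.card_eq_fintype_card, Fintype.card_subtype,
        Fintype.card_subtype] at hlt
    set B := Finset.univ.filter fun v : V => ∀ z ∈ E, P v y z with hB
    set A := Finset.univ.filter fun v : V => ∀ z ∈ Eᶜ, P v z x with hA
    have h1 : A.card ≤ Bᶜ.card := by
      apply Finset.card_le_card_of_injOn M _ hM.1.injOn
      intro a ha
      have ha' := (Finset.mem_filter.1 ha).2
      refine Finset.mem_coe.2 (Finset.mem_compl.2 fun hb => ?_)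
      have hb' := (Finset.mem_filter.1 hb).2
      obtain ⟨z, h, h'⟩ := hr a
      have hz : z ∈ E := by
        by_contra hz
        have h4 := ha' z hz
        rcases h with h | rfl
        · exact irr _ _ (tr _ _ _ _ h h4)
        · exact irr _ _ h4
      have h5 := hb' z hz
      rcases h' with h | rfl
      · exact irr _ _ (tr _ _ _ _ h h5)
      · exact irr _ _ h5
    have h3 := Finset.card_add_card_compl B
    omega
end

section
/- Let x ≠ y be two candidates. If the bipartite graph B(x,y) has no perfect matching, then strictly more than m/2 voters v have y ≻_v x. -/
/-- If `B(x,y)` has no perfect matching (for `x ≠ y`), then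
strictly more than `m/2` voters prefer `y` to `x`. -/
theorem stmt_15
    {V C : Type*} [Fintype V] [Nonempty V] [Fintype C]
    (P : V → C → C → Prop) (hP : ∀ v, IsStrictTotalOrder C (P v))
    (x y : C) (hxy : x ≠ y)
    (hnomatch : ¬ ∃ M : V → V, Function.Bijective M ∧
      ∀ v : V, ∃ z : C, (P v x z ∨ x = z) ∧ (P (M v) z y ∨ z = y)) :
    (Fintype.card V : ℝ) / 2 < (Nat.card {v : V // P v y x} : ℝ) := by
  classical
  by_contra hlt
  apply hnomatch
  have hxy' : ∀ v, ¬ P v y x → P v x y := by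
    intro v hv
    have := hP v
    rcases trichotomous_of (P v) x y with h | h | h
    · exact h
    · exact absurd h hxy
    · exact absurd h hv
  have hc : 2 * Fintype.card {v : V // P v y x} ≤ Fintype.card V := by
    rw [Nat.card_eq_fintype_card, not_lt, le_div_iff₀ (by norm_num)] at hlt
    have : Fintype.card {v : V // P v y x} * 2 ≤ Fintype.card V := by exact_mod_cast hlt
    omega
  have hcompl := Fintype.card_subtype_compl (fun v : V => P v y x)
  have hle : Fintype.card {v : V // P v y x} ≤ Fintype.card {v : V // ¬ P v y x} := by omega
  obtain ⟨f⟩ := Function.Embedding.nonempty_of_card_le hle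
  let g : {v : V // P v y x} ↪ V := f.trans (Function.Embedding.subtype _)
  let e : {v : V // P v y x} ≃ {v : V // v ∈ Set.range g} := Equiv.ofInjective g g.injective
  refine ⟨e.extendSubtype, e.extendSubtype.bijective, fun v => ?_⟩
  by_cases hv : P v y x
  · refine ⟨x, Or.inr rfl, Or.inl (hxy' _ ?_)⟩
    rw [Equiv.extendSubtype_apply_of_mem e v hv]
    exact (f ⟨v, hv⟩).2
  · exact ⟨y, Or.inl (hxy' v hv), Or.inr rfl⟩
end

section
/- Suppose that for every instance (every finite nonempty set of voters with strict total orders over every finite nonempty candidate set), the comparison graph contains no directed Hamiltonian cycle (no directed cycle visiting every candidate exactly once). Then for every instance, the comparison graph contains no directed cycle at all, i.e., it is acyclic. -/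
/-- `B(x,y)` has a perfect matching: a bijection `M : V → V` such that for each
voter `v` there is a candidate `z` with `x ⪰_v z` and `z ⪰_{M v} y`. -/
def HasPM {V C : Type} (P : V → C → C → Prop) (x y : C) : Prop :=
  ∃ M : V → V, Function.Bijective M ∧
    ∀ v : V, ∃ z : C, (P v x z ∨ x = z) ∧ (P (M v) z y ∨ z = y)

/-- The comparison graph has the edge `(y, x)` iff `B(x,y)` has no perfect
matching. -/
def CompEdge {V C : Type} (P : V → C → C → Prop) (y x : C) : Prop :=
  ¬ HasPM P x y

/-- If the comparison graph of every instance has no directed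
Hamiltonian cycle, then the comparison graph of every instance has no directed
cycle at all (cycles are encoded as nonempty duplicate-free lists whose
consecutive pairs — and the pair (last, head) — are all comparison-graph
edges). -/
theorem stmt_17
    (h : ∀ (V C : Type) [Fintype V] [Nonempty V] [Fintype C] [Nonempty C]
      (P : V → C → C → Prop), (∀ v, IsStrictTotalOrder C (P v)) →
      ¬ ∃ (l : List C) (hl : l ≠ []), l.Nodup ∧ (∀ c : C, c ∈ l) ∧
        List.Chain' (CompEdge P) l ∧ CompEdge P (l.getLast hl) (l.head hl)) :
    ∀ (V C : Type) [Fintype V] [Nonempty V] [Fintype C] [Nonempty C]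
      (P : V → C → C → Prop), (∀ v, IsStrictTotalOrder C (P v)) →
      ¬ ∃ (l : List C) (hl : l ≠ []), l.Nodup ∧
        List.Chain' (CompEdge P) l ∧ CompEdge P (l.getLast hl) (l.head hl) := by
  intro V C _ _ _ _ P hP
  rintro ⟨l, hl, hnd, hch, hlast⟩
  classical
  have key : ∀ a b : {c // c ∈ l}, CompEdge P a.1 b.1 →
      CompEdge (fun v (x y : {c // c ∈ l}) => P v x.1 y.1) a b := by
    rintro a b hab ⟨M, hM, hz⟩
    refine hab ⟨M, hM, fun v => ?_⟩
    obtain ⟨z, h1, h2⟩ := hz v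
    exact ⟨z.1, h1.imp id (congrArg Subtype.val), h2.imp id (congrArg Subtype.val)⟩
  have hl' : l.attach ≠ [] := by simpa using hl
  haveI : Nonempty {c // c ∈ l} := ⟨⟨l.head hl, List.head_mem hl⟩⟩
  refine h V {c // c ∈ l} (fun v x y => P v x.1 y.1) (fun v => ?_)
    ⟨l.attach, hl', List.nodup_attach.2 hnd, List.mem_attach l, ?_, ?_⟩
  · haveI := hP v
    exact (Subrel.relEmbedding (P v) (fun c => c ∈ l)).isStrictTotalOrder
  · have h1 : List.IsChain (CompEdge P) (l.attach.map Subtype.val) := by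
      rw [List.attach_map_subtype_val]; exact hch
    rw [List.isChain_map] at h1
    exact h1.imp key
  · apply key
    have e1 : (l.attach.getLast hl').1 = l.getLast hl := by simp
    have e2 : (l.attach.head hl').1 = l.head hl := by simp
    rw [e1, e2]; exact hlast
end

section
/- The following two statements are equivalent. (1) For every n ≥ 1, every choice of sets E_1, …, E_n ⊆ {1, …, n} with i ∈ E_i for all i, and every probability distribution D over strict total orders ≻ of {1, …, n}, there exists an index i such that Pr_{≻ ∼ D}[ i+1 ≻ z for all z ∈ E_i ] + Pr_{≻ ∼ D}[ z ≻ i for all z ∈ {1,…,n} \ E_i ] ≤ 1, where indices are taken cyclically (n + 1 is identified with 1). (2) For every instance (every finite nonempty set of voters with strict total orders over every finite nonempty candidate set), the comparison graph contains no directed Hamiltonian cycle (no directed cycle visiting every candidate exactly once). -/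
open Finset in
open Classical in
lemma noPM_iff {V C : Type} [Fintype V] [Fintype C] (P : V → C → C → Prop)
    (hP : ∀ v, IsStrictTotalOrder C (P v)) (x y : C) :
    ¬ HasPM P x y ↔ ∃ E : Finset C, x ∈ E ∧
      Fintype.card V < #{v : V | ∀ z ∈ E, P v y z} + #{v : V | ∀ z ∈ Eᶜ, P v z x} := by
  have irr : ∀ v a, ¬ P v a a := fun v a => (hP v).irrefl a
  have tr : ∀ v a b c, P v a b → P v b c → P v a c := fun v a b c => (hP v).trans a b c
  have tri : ∀ v a b, P v a b ∨ a = b ∨ P v b a := by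
    intro v a b
    haveI := hP v
    exact trichotomous_of (P v) a b
  constructor
  · intro h
    have h1 : ¬ ∀ A : Finset V, #A ≤ #{b : V | ∃ a ∈ A,
        (∃ z : C, (P a x z ∨ x = z) ∧ (P b z y ∨ z = y))} := by
      rw [Fintype.all_card_le_filter_rel_iff_exists_injective
        (fun a b : V => ∃ z : C, (P a x z ∨ x = z) ∧ (P b z y ∨ z = y))]
      rintro ⟨f, hf, hf'⟩
      exact h ⟨f, Finite.injective_iff_bijective.mp hf, hf'⟩
    push Not at h1
    obtain ⟨S, hS⟩ := h1
    have hSne : S.Nonempty := by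
      rw [← card_pos]; omega
    obtain ⟨s, hs⟩ := hSne
    refine ⟨univ.filter (fun z => ∃ v ∈ S, P v x z ∨ x = z), ?_, ?_⟩
    · simp only [mem_filter, mem_univ, true_and]
      exact ⟨s, hs, by simp⟩
    · set N : Finset V := {b : V | ∃ a ∈ S,
        (∃ z : C, (P a x z ∨ x = z) ∧ (P b z y ∨ z = y))} with hN
      have c1 : #S ≤ #{v : V | ∀ z ∈ (univ.filter (fun z => ∃ v ∈ S, P v x z ∨ x = z))ᶜ, P v z x} := by
        apply card_le_card
        intro v hv
        simp only [mem_filter, mem_univ, true_and, mem_compl]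
        intro z hz
        push Not at hz
        have := hz v hv
        rcases tri v x z with h | h | h
        · exact absurd h this.1
        · exact absurd h this.2
        · exact h
      have c2 : #Nᶜ ≤ #{v : V | ∀ z ∈ univ.filter (fun z => ∃ v ∈ S, P v x z ∨ x = z), P v y z} := by
        apply card_le_card
        intro b hb
        simp only [mem_filter, mem_univ, true_and, mem_compl, hN] at hb ⊢
        rintro z ⟨v, hv, hz⟩
        rcases tri b y z with h | h | h
        · exact h
        · exact absurd ⟨v, hv, z, hz, Or.inr h.symm⟩ hb
        · exact absurd ⟨v, hv, z, hz, Or.inl h⟩ hb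
      have := card_add_card_compl N
      omega
  · rintro ⟨E, hx, hE⟩ ⟨M, hM, h⟩
    have c1 : #(({v : V | ∀ z ∈ Eᶜ, P v z x} : Finset V).image M)
        = #{v : V | ∀ z ∈ Eᶜ, P v z x} := card_image_of_injective _ hM.injective
    have c2 : Disjoint ({v : V | ∀ z ∈ E, P v y z} : Finset V)
        (({v : V | ∀ z ∈ Eᶜ, P v z x} : Finset V).image M) := by
      rw [disjoint_left]
      intro b hb hb'
      simp only [mem_image, mem_filter, mem_univ, true_and] at hb hb'
      obtain ⟨v, hv, rfl⟩ := hb'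
      obtain ⟨z, hz1, hz2⟩ := h v
      have hzE : z ∈ E := by
        by_contra hz
        have h3 := hv z (mem_compl.mpr hz)
        rcases hz1 with h4 | h4
        · exact irr _ _ (tr _ _ _ _ h3 h4)
        · exact hz (h4 ▸ hx)
      have h5 := hb z hzE
      rcases hz2 with h4 | h4
      · exact irr _ _ (tr _ _ _ _ h5 h4)
      · subst h4; exact irr _ _ h5
    have c3 := card_le_univ (({v : V | ∀ z ∈ E, P v y z} : Finset V) ∪
        (({v : V | ∀ z ∈ Eᶜ, P v z x} : Finset V).image M))
    rw [card_union_of_disjoint c2, c1] at c3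
    omega

open Finset in
lemma exists_rank {n : ℕ} (r : Fin n → Fin n → Prop) (hr : IsStrictTotalOrder (Fin n) r) :
    ∃ σ : Equiv.Perm (Fin n), ∀ i j, r i j ↔ σ i < σ j := by
  classical
  have irr : ∀ a, ¬ r a a := fun a => hr.irrefl a
  have tr : ∀ a b c, r a b → r b c → r a c := fun a b c => hr.trans a b c
  have tri : ∀ a b, r a b ∨ a = b ∨ r b a := fun a b => trichotomous_of r a b
  have hlt : ∀ i, #{j | r j i} < n := by
    intro i
    have : #({j | r j i} : Finset (Fin n)) < #(univ : Finset (Fin n)) := by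
      apply card_lt_card
      rw [ssubset_univ_iff]
      intro h
      have : i ∈ ({j | r j i} : Finset (Fin n)) := by rw [h]; exact mem_univ i
      simp only [mem_filter, mem_univ, true_and] at this
      exact irr i this
    simpa using this
  let f : Fin n → Fin n := fun i => ⟨#{j | r j i}, hlt i⟩
  have hf : ∀ i j, r i j → f i < f j := by
    intro i j hij
    change #{k | r k i} < #{k | r k j}
    apply card_lt_card
    rw [ssubset_iff_of_subset]
    · exact ⟨i, by simpa using hij, by simpa using irr i⟩
    · intro k hk
      simp only [mem_filter, mem_univ, true_and] at hk ⊢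
      exact tr _ _ _ hk hij
  have hinj : Function.Injective f := by
    intro i j h
    rcases tri i j with h1 | h1 | h1
    · exact absurd (hf _ _ h1) (by simp [h])
    · exact h1
    · exact absurd (hf _ _ h1) (by simp [h])
  refine ⟨Equiv.ofBijective f (Finite.injective_iff_bijective.mp hinj), fun i j => ?_⟩
  simp only [Equiv.ofBijective_apply]
  refine ⟨hf i j, fun h => ?_⟩
  rcases tri i j with h1 | h1 | h1
  · exact h1
  · subst h1; exact absurd h (lt_irrefl _)
  · exact absurd (hf _ _ h1) (not_lt.mpr h.le)

/-- Index form of a Hamiltonian cycle. -/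
lemma cycle_of_list {C : Type} (R : C → C → Prop) (l : List C) (hl : l ≠ []) (hnd : l.Nodup)
    (hall : ∀ c, c ∈ l) (hch : List.IsChain R l) (hlast : R (l.getLast hl) (l.head hl)) :
    ∃ (n : ℕ) (_ : NeZero n) (c : Fin n ≃ C), ∀ i, R (c (i + 1)) (c i) := by
  have hpos : 0 < l.length := List.length_pos_iff.mpr hl
  haveI : NeZero l.length := ⟨hpos.ne'⟩
  have hbij : Function.Bijective (fun i : Fin l.length => l.get i.rev) := by
    constructor
    · intro i j h
      exact Fin.rev_injective (List.nodup_iff_injective_get.mp hnd h)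
    · intro c
      obtain ⟨i, hi⟩ := List.mem_iff_get.mp (hall c)
      exact ⟨i.rev, by simpa using hi⟩
  refine ⟨l.length, this, Equiv.ofBijective _ hbij, fun i => ?_⟩
  simp only [Equiv.ofBijective_apply, List.get_eq_getElem, Fin.val_rev]
  rw [List.isChain_iff_getElem] at hch
  rw [List.getLast_eq_getElem, List.head_eq_getElem] at hlast
  by_cases h : (i : ℕ) + 1 < l.length
  · have h1 : ((i + 1 : Fin l.length) : ℕ) = i + 1 := by
      rw [Fin.val_add, Fin.val_one', Nat.add_mod_mod, Nat.mod_eq_of_lt h]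
    have := hch (l.length - (i + 1 + 1)) (by omega)
    simp only [h1]
    convert this using 2
    omega
  · have h2 : (i : ℕ) + 1 = l.length := by have := i.2; omega
    have h1 : ((i + 1 : Fin l.length) : ℕ) = 0 := by
      rw [Fin.val_add, Fin.val_one', Nat.add_mod_mod, h2, Nat.mod_self]
    simp only [h1]
    convert hlast using 2
    omega

lemma list_of_cycle {n : ℕ} [NeZero n] (R : Fin n → Fin n → Prop)
    (h : ∀ i, R (i + 1) i) :
    ∃ (l : List (Fin n)) (hl : l ≠ []), l.Nodup ∧ (∀ c, c ∈ l) ∧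
        List.IsChain R l ∧ R (l.getLast hl) (l.head hl) := by
  have hn : 0 < n := Nat.pos_of_ne_zero (NeZero.ne n)
  have hl : List.ofFn (Fin.rev : Fin n → Fin n) ≠ [] := by
    rw [← List.length_pos_iff]; simpa using hn
  refine ⟨List.ofFn Fin.rev, hl, List.nodup_ofFn.mpr Fin.rev_injective, ?_, ?_, ?_⟩
  · intro c
    rw [List.mem_ofFn]
    exact ⟨c.rev, Fin.rev_rev c⟩
  · rw [List.isChain_iff_getElem]
    intro k hk
    simp only [List.length_ofFn] at hk
    simp only [List.getElem_ofFn]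
    convert h _ using 1
    ext
    rw [Fin.val_add, Fin.val_one', Nat.add_mod_mod, Fin.val_rev, Fin.val_rev,
      Nat.mod_eq_of_lt] <;> simp <;> omega
  · rw [List.getLast_eq_getElem, List.head_eq_getElem]
    simp only [List.getElem_ofFn]
    convert h _ using 1
    ext
    rw [Fin.val_add, Fin.val_one', Nat.add_mod_mod, Fin.val_rev, Fin.val_rev]
    simp
    rw [Nat.sub_add_cancel hn, Nat.mod_self]
    omega

open Finset in
lemma dir_one {n : ℕ} [NeZero n] {V C : Type} [Fintype V] [Nonempty V] [Fintype C]
    (P : V → C → C → Prop) (hP : ∀ v, IsStrictTotalOrder C (P v))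
    (c : Fin n ≃ C) (hc : ∀ i, CompEdge P (c (i + 1)) (c i)) :
    ∃ E : Fin n → Finset (Fin n), (∀ i, i ∈ E i) ∧
      ∃ w : Equiv.Perm (Fin n) → ℝ, (∀ σ, 0 ≤ w σ) ∧ (∑ σ, w σ) = 1 ∧
      ∀ i : Fin n, 1 <
        (∑ σ ∈ Finset.univ.filter (fun σ : Equiv.Perm (Fin n) =>
            ∀ z ∈ E i, σ (i + 1) < σ z), w σ) +
        (∑ σ ∈ Finset.univ.filter (fun σ : Equiv.Perm (Fin n) =>
            ∀ z ∈ (E i)ᶜ, σ z < σ i), w σ) := by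
  classical
  have hm : (0 : ℝ) < Fintype.card V := by exact_mod_cast Fintype.card_pos
  have hr : ∀ v, ∃ σ : Equiv.Perm (Fin n), ∀ i j, P v (c i) (c j) ↔ σ i < σ j := by
    intro v
    apply exists_rank (fun i j => P v (c i) (c j))
    have h := hP v
    exact { irrefl := fun a => h.irrefl (c a)
            trans := fun a b d => h.trans (c a) (c b) (c d)
            trichotomous := fun a b h1 h2 => c.injective (h.trichotomous _ _ h1 h2) }
  choose s hs using hr
  have hE : ∀ i, ∃ E : Finset C, c i ∈ E ∧
      Fintype.card V < #{v : V | ∀ z ∈ E, P v (c (i + 1)) z} +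
        #{v : V | ∀ z ∈ Eᶜ, P v z (c i)} := fun i => by
    convert (noPM_iff P hP (c i) (c (i + 1))).mp (hc i)
  choose E hE1 hE2 using hE
  have key : ∀ p : Equiv.Perm (Fin n) → Prop, ∀ _ : DecidablePred p,
      ∑ σ ∈ univ.filter p, (∑ v : V, if s v = σ then (1 : ℝ) / Fintype.card V else 0)
        = (#{v : V | p (s v)} : ℝ) / Fintype.card V := by
    intro p _
    rw [sum_comm]
    simp only [sum_ite_eq, mem_filter, mem_univ, true_and]
    rw [← sum_filter, sum_const, nsmul_eq_mul, mul_one_div]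
  refine ⟨fun i => univ.filter (fun j => c j ∈ E i), by simpa using hE1,
    fun σ => ∑ v : V, if s v = σ then (1 : ℝ) / Fintype.card V else 0, ?_, ?_, ?_⟩
  · intro σ
    apply sum_nonneg
    intro v _
    split_ifs <;> positivity
  · have := key (fun _ => True) inferInstance
    simp only [filter_true] at this
    rw [this, card_univ, div_self hm.ne']
  · intro i
    rw [key, key, ← add_div, lt_div_iff₀ hm, one_mul]
    have h := hE2 i
    have e1 : ({v : V | ∀ z ∈ E i, P v (c (i + 1)) z} : Finset V) =
        univ.filter (fun v : V => ∀ z ∈ univ.filter (fun j => c j ∈ E i), s v (i + 1) < s v z) := by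
      ext v
      simp only [mem_filter, mem_univ, true_and, ← hs]
      exact ⟨fun h z => h (c z), fun h z => by simpa using h (c.symm z)⟩
    have e2 : ({v : V | ∀ z ∈ (E i)ᶜ, P v z (c i)} : Finset V) =
        univ.filter (fun v : V => ∀ z ∈ (univ.filter (fun j => c j ∈ E i))ᶜ, s v z < s v i) := by
      ext v
      simp only [mem_filter, mem_univ, true_and, mem_compl, ← hs]
      exact ⟨fun h z => h (c z), fun h z => by simpa using h (c.symm z)⟩
    rw [e1, e2] at h
    exact_mod_cast h

open Finset in
lemma dir_two {n : ℕ} [NeZero n] (E : Fin n → Finset (Fin n)) (hE : ∀ i, i ∈ E i)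
    (w : Equiv.Perm (Fin n) → ℝ) (hw : ∀ σ, 0 ≤ w σ) (hw1 : (∑ σ, w σ) = 1)
    (h : ∀ i : Fin n, 1 <
        (∑ σ ∈ Finset.univ.filter (fun σ : Equiv.Perm (Fin n) =>
            ∀ z ∈ E i, σ (i + 1) < σ z), w σ) +
        (∑ σ ∈ Finset.univ.filter (fun σ : Equiv.Perm (Fin n) =>
            ∀ z ∈ (E i)ᶜ, σ z < σ i), w σ)) :
    ∃ (V : Type) (_ : Fintype V) (_ : Nonempty V) (P : V → Fin n → Fin n → Prop),
      (∀ v, IsStrictTotalOrder (Fin n) (P v)) ∧ ∀ i, CompEdge P (i + 1) i := by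
  classical
  set K : ℝ := ((Fintype.card (Equiv.Perm (Fin n)) : ℕ) : ℝ) with hK
  have hN : ∀ i : Fin n, ∃ N₀ : ℕ, ∀ N ≥ N₀, (N : ℝ) + 2 * K < N * (
        (∑ σ ∈ Finset.univ.filter (fun σ : Equiv.Perm (Fin n) =>
            ∀ z ∈ E i, σ (i + 1) < σ z), w σ) +
        (∑ σ ∈ Finset.univ.filter (fun σ : Equiv.Perm (Fin n) =>
            ∀ z ∈ (E i)ᶜ, σ z < σ i), w σ)) := by
    intro i
    have hi := h i
    generalize (∑ σ ∈ Finset.univ.filter (fun σ : Equiv.Perm (Fin n) =>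
            ∀ z ∈ E i, σ (i + 1) < σ z), w σ) +
        (∑ σ ∈ Finset.univ.filter (fun σ : Equiv.Perm (Fin n) =>
            ∀ z ∈ (E i)ᶜ, σ z < σ i), w σ) = S at hi
    have hpos : 0 < S - 1 := by linarith
    obtain ⟨N₀, hN₀⟩ := exists_nat_gt (2 * K / (S - 1))
    refine ⟨N₀, fun N hN => ?_⟩
    have : (N₀ : ℝ) ≤ N := by exact_mod_cast hN
    have h2 : 2 * K / (S - 1) < N := by linarith
    rw [div_lt_iff₀ hpos] at h2
    linarith
  choose N₀ hN₀ using hN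
  set N : ℕ := univ.sup N₀ with hNdef
  let k : Equiv.Perm (Fin n) → ℕ := fun σ => ⌊N * w σ⌋₊
  have hk1 : ∀ σ, (k σ : ℝ) ≤ N * w σ := fun σ =>
    Nat.floor_le (mul_nonneg (Nat.cast_nonneg _) (hw σ))
  have hk2 : ∀ σ, N * w σ - 1 ≤ (k σ : ℝ) := fun σ => (Nat.sub_one_lt_floor _).le
  have key : ∀ p : Equiv.Perm (Fin n) → Prop, ∀ _ : DecidablePred p,
      N * (∑ σ ∈ univ.filter p, w σ) - K ≤ (#{v : (Σ σ, Fin (k σ)) | p v.1} : ℝ) := by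
    intro p _
    have e : (#{v : (Σ σ, Fin (k σ)) | p v.1} : ℝ) = ∑ σ ∈ univ.filter p, (k σ : ℝ) := by
      have : ({v : (Σ σ, Fin (k σ)) | p v.1} : Finset _)
          = (univ.filter p).sigma (fun σ => univ) := by
        ext v; simp
      rw [this, card_sigma]
      simp
    rw [e]
    calc N * (∑ σ ∈ univ.filter p, w σ) - K
        ≤ N * (∑ σ ∈ univ.filter p, w σ) - #(univ.filter p) := by
          have : #(univ.filter p) ≤ Fintype.card (Equiv.Perm (Fin n)) := card_le_univ _
          have : (#(univ.filter p) : ℝ) ≤ K := by rw [hK]; exact_mod_cast this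
          linarith
      _ = ∑ σ ∈ univ.filter p, (N * w σ - 1) := by
          rw [sum_sub_distrib, mul_sum]; simp
      _ ≤ _ := sum_le_sum fun σ _ => hk2 σ
  have hcard : (Fintype.card (Σ σ, Fin (k σ)) : ℝ) ≤ N := by
    rw [Fintype.card_sigma]
    simp only [Fintype.card_fin, Nat.cast_sum]
    calc ∑ σ, (k σ : ℝ) ≤ ∑ σ, N * w σ := sum_le_sum fun σ _ => hk1 σ
      _ = N := by rw [← mul_sum, hw1, mul_one]
  have main : ∀ i, Fintype.card (Σ σ, Fin (k σ)) <
      #{v : (Σ σ, Fin (k σ)) | ∀ z ∈ E i, v.1 (i + 1) < v.1 z} +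
      #{v : (Σ σ, Fin (k σ)) | ∀ z ∈ (E i)ᶜ, v.1 z < v.1 i} := by
    intro i
    have h1 := key (fun σ => ∀ z ∈ E i, σ (i + 1) < σ z) inferInstance
    have h2 := key (fun σ => ∀ z ∈ (E i)ᶜ, σ z < σ i) inferInstance
    have h3 := hN₀ i N (le_sup (f := N₀) (mem_univ i))
    have : (Fintype.card (Σ σ, Fin (k σ)) : ℝ) <
      (#{v : (Σ σ, Fin (k σ)) | ∀ z ∈ E i, v.1 (i + 1) < v.1 z} : ℝ) +
      (#{v : (Σ σ, Fin (k σ)) | ∀ z ∈ (E i)ᶜ, v.1 z < v.1 i} : ℝ) := by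
      rw [mul_add] at h3
      linarith
    exact_mod_cast this
  have hP : ∀ v : (Σ σ, Fin (k σ)), IsStrictTotalOrder (Fin n) (fun a b => v.1 a < v.1 b) := by
    intro v
    exact { irrefl := fun a => lt_irrefl _
            trans := fun a b d h1 h2 => lt_trans h1 h2
            trichotomous := fun a b h1 h2 => v.1.injective
              (le_antisymm (not_lt.mp h2) (not_lt.mp h1)) }
  refine ⟨Σ σ, Fin (k σ), inferInstance, ?_, fun v a b => v.1 a < v.1 b, hP, ?_⟩
  · by_contra hne
    rw [not_nonempty_iff] at hne
    have := main 0
    simp at this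
  · intro i
    refine (noPM_iff _ hP _ _).mpr ⟨E i, hE i, ?_⟩
    convert main i

/-- The following are equivalent.
(1) For every `n ≥ 1` (here `Fin n` with `[NeZero n]`, addition being cyclic),
every family of sets `E i ⊆ Fin n` with `i ∈ E i`, and every probability
distribution over strict total orders of `Fin n` — encoded as a weight function
`w` on rank permutations `σ`, where `σ` represents the order `i ≻ j ↔ σ i < σ j` —
there is an index `i` with
`Pr[i+1 ≻ z ∀ z ∈ E i] + Pr[z ≻ i ∀ z ∈ (E i)ᶜ] ≤ 1`.
(2) The comparison graph of every instance has no directed Hamiltonian cycle. -/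
theorem stmt_18 :
    (∀ (n : ℕ) [NeZero n] (E : Fin n → Finset (Fin n)), (∀ i, i ∈ E i) →
      ∀ w : Equiv.Perm (Fin n) → ℝ, (∀ σ, 0 ≤ w σ) → (∑ σ, w σ) = 1 →
      ∃ i : Fin n,
        (∑ σ ∈ Finset.univ.filter (fun σ : Equiv.Perm (Fin n) =>
            ∀ z ∈ E i, σ (i + 1) < σ z), w σ) +
        (∑ σ ∈ Finset.univ.filter (fun σ : Equiv.Perm (Fin n) =>
            ∀ z ∈ (E i)ᶜ, σ z < σ i), w σ) ≤ 1)
    ↔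
    (∀ (V C : Type) [Fintype V] [Nonempty V] [Fintype C] [Nonempty C]
      (P : V → C → C → Prop), (∀ v, IsStrictTotalOrder C (P v)) →
      ¬ ∃ (l : List C) (hl : l ≠ []), l.Nodup ∧ (∀ c : C, c ∈ l) ∧
        List.Chain' (CompEdge P) l ∧ CompEdge P (l.getLast hl) (l.head hl)) := by
  constructor
  · intro h V C _ _ _ _ P hP ⟨l, hl, hnd, hall, hch, hlast⟩
    obtain ⟨n, hn, c, hc⟩ := cycle_of_list (CompEdge P) l hl hnd hall hch hlast
    obtain ⟨E, hE, w, hw, hw1, hlt⟩ := dir_one P hP c hc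
    obtain ⟨i, hi⟩ := h n E hE w hw hw1
    exact absurd hi (not_le.mpr (hlt i))
  · intro h n _ E hE w hw hw1
    by_contra hcon
    push Not at hcon
    obtain ⟨V, _, _, P, hP, hc⟩ := dir_two E hE w hw hw1 hcon
    exact h V (Fin n) P hP (list_of_cycle _ hc)
end

section
/- Suppose that for every n ≥ 1 and every constraint-choice graph G_n on 3n nodes there exists a nonempty index set S ⊆ {1, …, n} such that for every vertex set T ⊆ { a_i, b_i : i ∈ S } with |T| > |S|, the subgraph of G_n induced by {y_1, …, y_n} ∪ T contains a directed cycle. Then for every n ≥ 1, every choice of sets E_1, …, E_n ⊆ {1, …, n} with i ∈ E_i for all i, and every probability distribution D over strict total orders ≻ of {1, …, n}, there exists an index i such that Pr_{≻ ∼ D}[ i+1 ≻ z for all z ∈ E_i ] + Pr_{≻ ∼ D}[ z ≻ i for all z ∈ {1,…,n} \ E_i ] ≤ 1, where indices are taken cyclically (n + 1 is identified with 1). -/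
/-- Nodes of a constraint-choice graph: `y`-nodes, `a`-nodes and `b`-nodes,
each indexed by `Fin n`. -/
abbrev CCNode (n : ℕ) : Type := Fin n ⊕ (Fin n ⊕ Fin n)

def Ynode {n : ℕ} (i : Fin n) : CCNode n := Sum.inl i
def Anode {n : ℕ} (i : Fin n) : CCNode n := Sum.inr (Sum.inl i)
def Bnode {n : ℕ} (i : Fin n) : CCNode n := Sum.inr (Sum.inr i)

/-- A directed graph `G` on the `3n` nodes is a constraint-choice graph if
(indices cyclic, via `Fin n` arithmetic):
for each `i` it contains the edges `(y_i, a_{i-1})`, `(y_i, b_{i-1})`,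
`(a_i, y_i)`, `(b_i, y_i)`; for each `i, j` with `j ≠ i`, `j ≠ i − 1` it
contains exactly one of the edges `(a_j, y_i)` and `(y_i, b_j)`; and it has no
other edges. -/
def IsConstraintChoiceGraph {n : ℕ} [NeZero n]
    (G : CCNode n → CCNode n → Prop) : Prop :=
  (∀ i : Fin n, G (Ynode i) (Anode (i - 1)) ∧ G (Ynode i) (Bnode (i - 1)) ∧
    G (Anode i) (Ynode i) ∧ G (Bnode i) (Ynode i)) ∧
  (∀ i j : Fin n, j ≠ i → j ≠ i - 1 →
    (G (Anode j) (Ynode i) ↔ ¬ G (Ynode i) (Bnode j))) ∧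
  (∀ u v : CCNode n, G u v →
    (∃ i : Fin n, (u = Ynode i ∧ (v = Anode (i - 1) ∨ v = Bnode (i - 1))) ∨
      ((u = Anode i ∨ u = Bnode i) ∧ v = Ynode i)) ∨
    (∃ i j : Fin n, j ≠ i ∧ j ≠ i - 1 ∧
      ((u = Anode j ∧ v = Ynode i) ∨ (u = Ynode i ∧ v = Bnode j))))

lemma chain_mono_aux {α : Type*} (G : α → α → Prop) (f : α → ℤ) :
    ∀ (l : List α) (hl : l ≠ []), List.IsChain G l →
      (∀ u ∈ l, ∀ v ∈ l, G u v → f u < f v) → f (l.head hl) ≤ f (l.getLast hl) := by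
  intro l
  induction l with
  | nil => intro hl; exact absurd rfl hl
  | cons x t ih =>
    intro hl hc hm
    cases t with
    | nil => simp
    | cons y t =>
      rw [List.isChain_cons_cons] at hc
      have h1 := ih (by simp) hc.2 (fun u hu v hv => hm u (by simp [hu]) v (by simp [hv]))
      have h2 := hm x (by simp) y (by simp) hc.1
      simp only [List.head_cons] at h1 ⊢
      rw [List.getLast_cons (by simp)]
      omega

/-- The constraint-choice graph attached to a family `E`. -/
def ccGraph {n : ℕ} [NeZero n] (E : Fin n → Finset (Fin n)) : CCNode n → CCNode n → Prop
  | Sum.inl i, Sum.inr (Sum.inl j) => i = j + 1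
  | Sum.inl i, Sum.inr (Sum.inr j) => i ∉ E j
  | Sum.inr (Sum.inl j), Sum.inl i => i ∈ E j
  | Sum.inr (Sum.inr j), Sum.inl i => i = j
  | _, _ => False

lemma ccGraph_is {n : ℕ} [NeZero n] (E : Fin n → Finset (Fin n)) (hE : ∀ i, i ∈ E i)
    (hE' : ∀ i, i + 1 ∉ E i) : IsConstraintChoiceGraph (ccGraph E) := by
  refine ⟨fun i => ⟨?_, ?_, ?_, ?_⟩, fun i j _ _ => ?_, ?_⟩
  · simp [ccGraph, Ynode, Anode]
  · have := hE' (i - 1)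
    simpa [ccGraph, Ynode, Bnode] using this
  · simpa [ccGraph, Ynode, Anode] using hE i
  · simp [ccGraph, Ynode, Bnode]
  · simp [ccGraph, Ynode, Anode, Bnode]
  · rintro (i | j | j) (i' | j' | j') h <;> simp only [ccGraph] at h
    · left
      exact ⟨i, Or.inl ⟨rfl, Or.inl (by subst h; simp [Anode])⟩⟩
    · by_cases hj : j' = i - 1
      · left
        exact ⟨i, Or.inl ⟨rfl, Or.inr (by subst hj; rfl)⟩⟩
      · right
        refine ⟨i, j', ?_, hj, Or.inr ⟨rfl, rfl⟩⟩
        rintro rfl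
        exact h (hE _)
    · by_cases hj : j = i'
      · left
        exact ⟨i', Or.inr ⟨Or.inl (by subst hj; rfl), rfl⟩⟩
      · right
        refine ⟨i', j, hj, ?_, Or.inl ⟨rfl, rfl⟩⟩
        rintro rfl
        have := hE' (i' - 1)
        simp at this
        exact this h
    · left
      exact ⟨i', Or.inr ⟨Or.inr (by subst h; rfl), rfl⟩⟩

/-- Potential increasing along the edges. -/
def ccPot {n : ℕ} [NeZero n] (σ : Equiv.Perm (Fin n)) : CCNode n → ℤ
  | Sum.inl i => 2 * ((σ i : ℕ) : ℤ)
  | Sum.inr (Sum.inl j) => 2 * ((σ (j + 1) : ℕ) : ℤ) + 1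
  | Sum.inr (Sum.inr j) => 2 * ((σ j : ℕ) : ℤ) - 1

/-- Suppose that for every `n ≥ 1` and every constraint-choice
graph `G` on `3n` nodes there is a nonempty index set `S ⊆ Fin n` such that for
every vertex set `T ⊆ {a_i, b_i : i ∈ S}` with `|T| > |S|`, the subgraph of `G`
induced by all the `y`-nodes together with `T` contains a directed cycle
(encoded as a nonempty duplicate-free list of vertices of the induced subgraph
whose consecutive pairs — and the pair (last, head) — are all edges of `G`).
Then for every `n ≥ 1`, every family `E i ⊆ Fin n` with `i ∈ E i`, and every
probability distribution over strict total orders of `Fin n` — encoded as a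
weight function `w` on rank permutations `σ`, where `σ` represents the order
`i ≻ j ↔ σ i < σ j` — there is an index `i` with
`Pr[i+1 ≻ z ∀ z ∈ E i] + Pr[z ≻ i ∀ z ∈ (E i)ᶜ] ≤ 1` (indices cyclic). -/
theorem stmt_19
    (hcc : ∀ (n : ℕ) [NeZero n] (G : CCNode n → CCNode n → Prop),
      IsConstraintChoiceGraph G →
      ∃ S : Finset (Fin n), S.Nonempty ∧
        ∀ T : Finset (CCNode n),
          (∀ t ∈ T, ∃ i ∈ S, t = Anode i ∨ t = Bnode i) →
          S.card < T.card →
          ∃ (l : List (CCNode n)) (hl : l ≠ []), l.Nodup ∧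
            (∀ u ∈ l, (∃ i : Fin n, u = Ynode i) ∨ u ∈ T) ∧
            List.Chain' G l ∧ G (l.getLast hl) (l.head hl)) :
    ∀ (n : ℕ) [NeZero n] (E : Fin n → Finset (Fin n)), (∀ i, i ∈ E i) →
      ∀ w : Equiv.Perm (Fin n) → ℝ, (∀ σ, 0 ≤ w σ) → (∑ σ, w σ) = 1 →
      ∃ i : Fin n,
        (∑ σ ∈ Finset.univ.filter (fun σ : Equiv.Perm (Fin n) =>
            ∀ z ∈ E i, σ (i + 1) < σ z), w σ) +
        (∑ σ ∈ Finset.univ.filter (fun σ : Equiv.Perm (Fin n) =>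
            ∀ z ∈ (E i)ᶜ, σ z < σ i), w σ) ≤ 1 := by
  intro n _ E hE w hw hw1
  by_contra! hcon
  have hE' : ∀ i, i + 1 ∉ E i := by
    intro i hi
    have h := hcon i
    rw [Finset.filter_false_of_mem (fun σ _ h => lt_irrefl _ (h _ hi)), Finset.sum_empty,
      zero_add] at h
    have := Finset.sum_le_sum_of_subset_of_nonneg (f := w)
      (Finset.filter_subset (fun σ : Equiv.Perm (Fin n) => ∀ z ∈ (E i)ᶜ, σ z < σ i) Finset.univ)
      (fun σ _ _ => hw σ)
    linarith
  obtain ⟨S, hS, hT⟩ := hcc n (ccGraph E) (ccGraph_is E hE hE')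
  have key : ∀ σ : Equiv.Perm (Fin n),
      (S.filter (fun i => ∀ z ∈ E i, σ (i + 1) < σ z)).card +
      (S.filter (fun i => ∀ z ∈ (E i)ᶜ, σ z < σ i)).card ≤ S.card := by
    intro σ
    by_contra! hlt
    set A := S.filter (fun i => ∀ z ∈ E i, σ (i + 1) < σ z) with hA
    set B := S.filter (fun i => ∀ z ∈ (E i)ᶜ, σ z < σ i) with hB
    obtain ⟨l, hl, -, hmem, hch, hlast⟩ := hT ((A.disjSum B).map Function.Embedding.inr) (by
      intro t ht
      rw [Finset.mem_map] at ht
      obtain ⟨(j | j), hj, rfl⟩ := ht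
      · exact ⟨j, (Finset.mem_filter.1 (Finset.inl_mem_disjSum.1 hj)).1, Or.inl rfl⟩
      · exact ⟨j, (Finset.mem_filter.1 (Finset.inr_mem_disjSum.1 hj)).1, Or.inr rfl⟩)
      (by rw [Finset.card_map, Finset.card_disjSum]; exact hlt)
    have hAm : ∀ j, (Sum.inr (Sum.inl j) : CCNode n) ∈ l → ∀ z ∈ E j, σ (j + 1) < σ z := by
      intro j hj
      rcases hmem _ hj with ⟨i, hi⟩ | h
      · simp [Ynode] at hi
      · simp [A] at h
        exact h.2
    have hBm : ∀ j, (Sum.inr (Sum.inr j) : CCNode n) ∈ l → ∀ z, z ∉ E j → σ z < σ j := by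
      intro j hj
      rcases hmem _ hj with ⟨i, hi⟩ | h
      · simp [Ynode] at hi
      · simp [B] at h
        exact h.2
    have hm : ∀ u ∈ l, ∀ v ∈ l, ccGraph E u v → ccPot σ u < ccPot σ v := by
      rintro (i | j | j) hu (i' | j' | j') hv h <;> simp only [ccGraph] at h <;>
        simp only [ccPot]
      · subst h; omega
      · have := hBm _ hv _ h
        rw [Fin.lt_def] at this; omega
      · have := hAm _ hu _ h
        rw [Fin.lt_def] at this; omega
      · subst h; omega
    have h1 := chain_mono_aux (ccGraph E) (ccPot σ) l hl hch hm
    have h2 := hm _ (List.getLast_mem hl) _ (List.head_mem hl) hlast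
    omega
  have hsum := Finset.sum_lt_sum_of_nonempty hS (fun i _ => hcon i)
  have heq : ∑ i ∈ S, ((∑ σ ∈ Finset.univ.filter (fun σ : Equiv.Perm (Fin n) =>
            ∀ z ∈ E i, σ (i + 1) < σ z), w σ) +
        (∑ σ ∈ Finset.univ.filter (fun σ : Equiv.Perm (Fin n) =>
            ∀ z ∈ (E i)ᶜ, σ z < σ i), w σ)) =
      ∑ σ, w σ * (((S.filter (fun i => ∀ z ∈ E i, σ (i + 1) < σ z)).card +
      (S.filter (fun i => ∀ z ∈ (E i)ᶜ, σ z < σ i)).card : ℕ) : ℝ) := by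
    simp_rw [Finset.sum_add_distrib, Finset.sum_filter]
    rw [Finset.sum_comm, add_comm, Finset.sum_comm, add_comm, ← Finset.sum_add_distrib]
    refine Finset.sum_congr rfl fun σ _ => ?_
    rw [← Finset.sum_filter, ← Finset.sum_filter, Finset.sum_const, Finset.sum_const]
    push_cast
    simp only [nsmul_eq_mul]
    ring
  rw [heq] at hsum
  have hle : ∑ σ, w σ * (((S.filter (fun i => ∀ z ∈ E i, σ (i + 1) < σ z)).card +
      (S.filter (fun i => ∀ z ∈ (E i)ᶜ, σ z < σ i)).card : ℕ) : ℝ) ≤ ∑ σ, w σ * (S.card : ℝ) :=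
    Finset.sum_le_sum fun σ _ => mul_le_mul_of_nonneg_left (by exact_mod_cast key σ) (hw σ)
  rw [← Finset.sum_mul, hw1] at hle
  simp only [Finset.sum_const, nsmul_eq_mul, mul_one] at hsum
  linarith
end
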